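/- arXiv:0912.5091 — 6 statements merged into one kernel-verified Lean document; each statement's English description precedes it below -/
import Mathlib

section
/- If near-normal sequences NN(l) exist, base sequences BS(r,s) exist, and Williamson-type matrices of order w exist, then a Hadamard matrix of order 4(2l+1)(r+s)w exists. -/
open Finset Matrix Kronecker

/-- Nonperiodic autocorrelation `N_X(j)` of a sequence of length `m` (0-indexed):
`N_X(j) = ∑_{k=0}^{m-j-1} x_k x_{k+j}`. -/
def autocorr (m : ℕ) (X : ℕ → ℤ) (j : ℕ) : ℤ :=
  ∑ k ∈ Finset.range (m - j), X k * X (k + j)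

/-- A binary (±1) sequence of length `m`. -/
def IsBinarySeq (m : ℕ) (X : ℕ → ℤ) : Prop :=
  ∀ i < m, X i = 1 ∨ X i = -1

/-- Base sequences `BS(r,s)`: binary sequences `A, B` of length `r` and `C, D` of
length `s` whose nonperiodic autocorrelations sum to zero for all `j ≥ 1`. -/
def IsBaseSeq (r s : ℕ) (A B C D : ℕ → ℤ) : Prop :=
  IsBinarySeq r A ∧ IsBinarySeq r B ∧ IsBinarySeq s C ∧ IsBinarySeq s D ∧
    ∀ j, 1 ≤ j →
      autocorr r A j + autocorr r B j + autocorr s C j + autocorr s D j = 0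

/-- A Golay pair of length `g`. -/
def IsGolayPair (g : ℕ) (A B : ℕ → ℤ) : Prop :=
  IsBinarySeq g A ∧ IsBinarySeq g B ∧
    ∀ j, 1 ≤ j → autocorr g A j + autocorr g B j = 0

/-- Normal sequences `NS(n)`: base sequences in `BS(n+1,n)` whose first two
sequences agree in the first `n` entries. -/
def IsNormalSeq (n : ℕ) (A B C D : ℕ → ℤ) : Prop :=
  IsBaseSeq (n + 1) n A B C D ∧ ∀ i < n, B i = A i

/-- Near-normal sequences `NN(n)`: base sequences in `BS(n+1,n)` with
`b_i = (-1)^(i-1) a_i` for `i = 1, …, n` (0-indexed: `B i = (-1)^i * A i`). -/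
def IsNearNormalSeq (n : ℕ) (A B C D : ℕ → ℤ) : Prop :=
  IsBaseSeq (n + 1) n A B C D ∧ ∀ i < n, B i = (-1) ^ i * A i

/-- T-sequences of length `t`: four `{-1,0,1}`-sequences such that at every
position exactly one of them is nonzero, and the sum of their nonperiodic
autocorrelations vanishes for all `j ≥ 1`. -/
def IsTSeq (t : ℕ) (T₁ T₂ T₃ T₄ : ℕ → ℤ) : Prop :=
  (∀ i < t, T₁ i ∈ ({-1, 0, 1} : Set ℤ)) ∧
  (∀ i < t, T₂ i ∈ ({-1, 0, 1} : Set ℤ)) ∧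
  (∀ i < t, T₃ i ∈ ({-1, 0, 1} : Set ℤ)) ∧
  (∀ i < t, T₄ i ∈ ({-1, 0, 1} : Set ℤ)) ∧
  (∀ i < t,
    (T₁ i ≠ 0 ∧ T₂ i = 0 ∧ T₃ i = 0 ∧ T₄ i = 0) ∨
    (T₁ i = 0 ∧ T₂ i ≠ 0 ∧ T₃ i = 0 ∧ T₄ i = 0) ∨
    (T₁ i = 0 ∧ T₂ i = 0 ∧ T₃ i ≠ 0 ∧ T₄ i = 0) ∨
    (T₁ i = 0 ∧ T₂ i = 0 ∧ T₃ i = 0 ∧ T₄ i ≠ 0)) ∧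
  ∀ j, 1 ≤ j →
    autocorr t T₁ j + autocorr t T₂ j + autocorr t T₃ j + autocorr t T₄ j = 0

/-- An orthogonal design `OD(4d; d,d,d,d)`: four `4d × 4d` matrices with entries
in `{-1,0,1}`, pairwise disjoint supports covering every position, with
`Aᵢ Aᵢᵀ = d·I` and `Aᵢ Aⱼᵀ + Aⱼ Aᵢᵀ = 0` for `i ≠ j`. -/
def IsOD (d : ℕ) (A : Fin 4 → Matrix (Fin (4 * d)) (Fin (4 * d)) ℤ) : Prop :=
  (∀ k i j, A k i j ∈ ({-1, 0, 1} : Set ℤ)) ∧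
  (∀ i j, ∃! k : Fin 4, A k i j ≠ 0) ∧
  (∀ k, A k * (A k)ᵀ = (d : ℤ) • 1) ∧
  (∀ k l, k ≠ l → A k * (A l)ᵀ + A l * (A k)ᵀ = 0)

/-- Williamson-type matrices of order `w`: four pairwise amicable `±1` matrices
with `∑ Wᵢ Wᵢᵀ = 4w·I`. -/
def IsWilliamsonType (w : ℕ) (W : Fin 4 → Matrix (Fin w) (Fin w) ℤ) : Prop :=
  (∀ k i j, W k i j = 1 ∨ W k i j = -1) ∧
  (∀ k l, W k * (W l)ᵀ = W l * (W k)ᵀ) ∧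
  (∑ k, W k * (W k)ᵀ) = ((4 * w : ℕ) : ℤ) • 1

/-- A Hadamard matrix: a `±1` matrix `H` with `H Hᵀ = m·I`, where `m` is the
size of the (finite) index type. -/
def IsHadamardMatrix {n : Type*} [Fintype n] [DecidableEq n] (H : Matrix n n ℤ) : Prop :=
  (∀ i j, H i j = 1 ∨ H i j = -1) ∧ H * Hᵀ = (Fintype.card n : ℤ) • 1

open LaurentPolynomial

/-- The Laurent polynomial `∑ k < m, X k * T ^ (d * k)` of a sequence of length `m`. -/
noncomputable def genFun (d : ℤ) (m : ℕ) (X : ℕ → ℤ) : ℤ[T;T⁻¹] :=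
  ∑ k ∈ range m, C (X k) * T (d * k)

theorem autocorr_succ (m : ℕ) (X : ℕ → ℤ) (j : ℕ) :
    autocorr (m + 1) X (j + 1) =
      autocorr m X (j + 1) + if j < m then X (m - 1 - j) * X m else 0 := by
  unfold autocorr
  split_ifs with h
  · have e : m + 1 - (j + 1) = (m - (j + 1)) + 1 := by omega
    rw [e, sum_range_succ]
    have e1 : m - (j + 1) = m - 1 - j := by omega
    have e2 : m - (j + 1) + (j + 1) = m := by omega
    rw [e2, e1]
  · have e : m + 1 - (j + 1) = 0 := by omega
    have e' : m - (j + 1) = 0 := by omega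
    rw [e, e']
    simp

theorem genFun_mul_invert (d : ℤ) (X : ℕ → ℤ) (K m : ℕ) (hm : m ≤ K) :
    genFun d m X * invert (genFun d m X) = C (∑ k ∈ range m, X k ^ 2) +
      ∑ j ∈ range K, C (autocorr m X (j + 1)) * (T (d * (j + 1)) + T (-(d * (j + 1)))) := by
  induction m with
  | zero => simp [genFun, autocorr]
  | succ m ih =>
    have hs : genFun d (m + 1) X = genFun d m X + C (X m) * T (d * m) := by
      simp [genFun, sum_range_succ]
    have hsum : ∀ F : ℕ → ℤ[T;T⁻¹], ∑ j ∈ range K, (if j < m then F j else 0) =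
        ∑ j ∈ range m, F j := by
      intro F
      rw [← sum_filter]
      congr 1
      ext j
      simp
      omega
    have h1 : ∑ j ∈ range K, C (autocorr (m + 1) X (j + 1)) *
          (T (d * (j + 1)) + T (-(d * (j + 1)))) =
        ∑ j ∈ range K, C (autocorr m X (j + 1)) * (T (d * (j + 1)) + T (-(d * (j + 1)))) +
        ∑ j ∈ range m, C (X (m - 1 - j) * X m) *
          (T (d * (j + 1)) + T (-(d * (j + 1))) : ℤ[T;T⁻¹]) := by
      rw [← hsum, ← sum_add_distrib]
      refine sum_congr rfl fun j _ => ?_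
      rw [autocorr_succ]
      split_ifs <;> simp [add_mul]
    have h2 : ∑ j ∈ range m, C (X (m - 1 - j) * X m) *
          (T (d * (j + 1)) + T (-(d * (j + 1))) : ℤ[T;T⁻¹]) =
        C (X m) * T (d * m) * invert (genFun d m X) +
          C (X m) * T (-(d * m)) * genFun d m X := by
      rw [← sum_range_reflect]
      unfold genFun
      rw [map_sum, mul_sum, mul_sum, ← sum_add_distrib]
      refine sum_congr rfl fun j hj => ?_
      rw [mem_range] at hj
      have e : m - 1 - (m - 1 - j) = j := by omega
      have e2 : ((m - 1 - j : ℕ) : ℤ) = m - 1 - j := by omega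
      have e3 : d * ((m - 1 - j : ℕ) + 1 : ℤ) = d * m + -(d * j) := by rw [e2]; ring
      have e4 : -(d * m + -(d * j)) = -(d * m) + d * j := by ring
      rw [e, e3, e4, T_add, T_add]
      simp only [map_mul, invert_C, invert_T]
      ring
    rw [h1, h2, hs, map_add, sum_range_succ, map_add]
    have ih' := ih (by omega)
    have hT : (T (d * m) : ℤ[T;T⁻¹]) * T (-(d * m)) = 1 := by rw [← T_add]; simp
    simp only [map_mul, invert_C, invert_T, map_pow]
    linear_combination ih' + C (X m) ^ 2 * hT

/-- Two `{-1,0,1}`-sequences of length `n` with complementary supports. -/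
def IsComplSeq (n : ℕ) (x y : ℕ → ℤ) : Prop :=
  ∀ i < n, (y i = 0 ∧ (x i = 1 ∨ x i = -1)) ∨ (x i = 0 ∧ (y i = 1 ∨ y i = -1))

theorem C_two_mul_cancel {f g : ℤ[T;T⁻¹]} (h : C 2 * f = C 2 * g) : f = g := by
  rw [← smul_eq_C_mul, ← smul_eq_C_mul] at h
  ext n
  have := congrArg (fun p => p.coeff n) h
  simp only [AddMonoidAlgebra.coeff_smul, Finsupp.smul_apply, smul_eq_mul] at this
  omega

theorem exists_halves (A B : ℕ → ℤ) (m : ℕ) (hA : IsBinarySeq m A) (hB : IsBinarySeq m B) :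
    ∃ x y : ℕ → ℤ, IsComplSeq m x y ∧ (∀ i < m, A i = x i + y i) ∧ (∀ i < m, B i = x i - y i) := by
  refine ⟨fun i => (A i + B i) / 2, fun i => (A i - B i) / 2, ?_, ?_, ?_⟩ <;> intro i hi <;>
    rcases hA i hi with a | a <;> rcases hB i hi with b | b <;> simp [a, b]

theorem genFun_congr (d : ℤ) (m : ℕ) {X Y : ℕ → ℤ} (h : ∀ i < m, X i = Y i) :
    genFun d m X = genFun d m Y :=
  sum_congr rfl fun i hi => by rw [h i (mem_range.1 hi)]

theorem genFun_add (d : ℤ) (m : ℕ) (X Y : ℕ → ℤ) :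
    genFun d m (fun i => X i + Y i) = genFun d m X + genFun d m Y := by
  simp [genFun, add_mul, sum_add_distrib]

theorem genFun_sub (d : ℤ) (m : ℕ) (X Y : ℕ → ℤ) :
    genFun d m (fun i => X i - Y i) = genFun d m X - genFun d m Y := by
  simp [genFun, sub_mul, sum_sub_distrib]

theorem IsBinarySeq.sum_sq {m : ℕ} {A : ℕ → ℤ} (hA : IsBinarySeq m A) :
    ∑ k ∈ range m, A k ^ 2 = m := by
  rw [sum_congr rfl (g := fun _ => (1 : ℤ)) fun i hi => ?_]
  · simp
  · rcases hA i (mem_range.1 hi) with a | a <;> simp [a]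

theorem IsBaseSeq.genFun_norm {r s : ℕ} {A B C D : ℕ → ℤ} (h : IsBaseSeq r s A B C D) (d : ℤ) :
    genFun d r A * invert (genFun d r A) + genFun d r B * invert (genFun d r B) +
      genFun d s C * invert (genFun d s C) + genFun d s D * invert (genFun d s D) =
      LaurentPolynomial.C (2 * (r + s) : ℤ) := by
  obtain ⟨hA, hB, hC, hD, h0⟩ := h
  rw [genFun_mul_invert d A (r + s) r (by omega), genFun_mul_invert d B (r + s) r (by omega),
    genFun_mul_invert d C (r + s) s (by omega), genFun_mul_invert d D (r + s) s (by omega),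
    hA.sum_sq, hB.sum_sq, hC.sum_sq, hD.sum_sq]
  have hz : ∑ j ∈ range (r + s), (LaurentPolynomial.C (autocorr r A (j + 1)) +
      LaurentPolynomial.C (autocorr r B (j + 1)) + LaurentPolynomial.C (autocorr s C (j + 1)) +
      LaurentPolynomial.C (autocorr s D (j + 1))) * (T (d * (j + 1)) + T (-(d * (j + 1)))) =
      (0 : ℤ[T;T⁻¹]) := by
    refine sum_eq_zero fun j _ => ?_
    rw [← map_add, ← map_add, ← map_add, h0 (j + 1) (by omega)]
    simp
  simp only [add_mul, sum_add_distrib] at hz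
  have hc : LaurentPolynomial.C (2 * (r + s) : ℤ) = (LaurentPolynomial.C (r : ℤ) +
      LaurentPolynomial.C (r : ℤ) + LaurentPolynomial.C (s : ℤ) + LaurentPolynomial.C (s : ℤ) :
        ℤ[T;T⁻¹]) := by
    rw [← map_add, ← map_add, ← map_add]
    congr 1
    ring
  rw [hc]
  linear_combination hz

/-- Halving sums and differences of base sequences. -/
theorem IsBaseSeq.exists_compl {r s : ℕ} {A B C D : ℕ → ℤ} (h : IsBaseSeq r s A B C D) :
    ∃ x y z w : ℕ → ℤ, IsComplSeq r x y ∧ IsComplSeq s z w ∧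
      (∀ i < r, A i = x i + y i) ∧ (∀ i < r, B i = x i - y i) ∧
      (∀ i < s, C i = z i + w i) ∧ (∀ i < s, D i = z i - w i) ∧
      ∀ d, genFun d r x * invert (genFun d r x) + genFun d r y * invert (genFun d r y) +
        genFun d s z * invert (genFun d s z) + genFun d s w * invert (genFun d s w) =
        LaurentPolynomial.C (r + s : ℤ) := by
  obtain ⟨x, y, hxy, hA, hB⟩ := exists_halves A B r h.1 h.2.1
  obtain ⟨z, w, hzw, hC, hD⟩ := exists_halves C D s h.2.2.1 h.2.2.2.1
  refine ⟨x, y, z, w, hxy, hzw, hA, hB, hC, hD, fun d => C_two_mul_cancel ?_⟩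
  have hn := h.genFun_norm d
  rw [genFun_congr d r hA, genFun_congr d r hB, genFun_congr d s hC, genFun_congr d s hD,
    genFun_add, genFun_add, genFun_sub, genFun_sub] at hn
  simp only [map_add, map_sub, map_mul] at hn ⊢
  have h2 : (LaurentPolynomial.C 2 : ℤ[T;T⁻¹]) = 2 := map_ofNat _ 2
  rw [h2] at hn ⊢
  linear_combination hn

theorem genFun_reverse (d : ℤ) (n : ℕ) (X : ℕ → ℤ) :
    genFun d n (fun k => X (n - 1 - k)) = T (d * (n - 1)) * invert (genFun d n X) := by
  unfold genFun
  rw [← sum_range_reflect, map_sum, mul_sum]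
  refine sum_congr rfl fun k hk => ?_
  rw [mem_range] at hk
  have e : n - 1 - (n - 1 - k) = k := by omega
  have e2 : ((n - 1 - k : ℕ) : ℤ) = n - 1 - k := by omega
  have e3 : d * ((n : ℤ) - 1 - k) = d * (n - 1) + -(d * k) := by ring
  dsimp only
  rw [e, e2, e3, T_add, map_mul, invert_C, invert_T]
  ring

theorem IsComplSeq.symm {n : ℕ} {x y : ℕ → ℤ} (h : IsComplSeq n x y) : IsComplSeq n y x :=
  fun i hi => (h i hi).symm

theorem IsComplSeq.reverse {n : ℕ} {x y : ℕ → ℤ} (h : IsComplSeq n x y) :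
    IsComplSeq n (fun k => x (n - 1 - k)) (fun k => y (n - 1 - k)) :=
  fun i hi => h (n - 1 - i) (by omega)

/-- Four Laurent polynomials whose coefficients at `T ^ 0, …, T ^ (n - 1)` are those of
four `{-1,0,1}`-sequences, exactly one of which is nonzero at each position. -/
def IsTiling (n : ℕ) (v : Fin 4 → ℤ[T;T⁻¹]) : Prop :=
  ∃ κ : ℕ → Fin 4, ∃ ε : ℕ → ℤ, (∀ i < n, ε i = 1 ∨ ε i = -1) ∧
    ∀ j, v j = ∑ i ∈ range n, if κ i = j then C (ε i) * T i else 0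

theorem IsTiling.zero : IsTiling 0 (fun _ => 0) :=
  ⟨fun _ => 0, fun _ => 1, by simp, by simp⟩

theorem IsTiling.append {m n : ℕ} {v w : Fin 4 → ℤ[T;T⁻¹]} (hv : IsTiling m v)
    (hw : IsTiling n w) : IsTiling (m + n) (fun j => v j + T m * w j) := by
  obtain ⟨κ, ε, h1, h2⟩ := hv
  obtain ⟨κ', ε', h1', h2'⟩ := hw
  refine ⟨fun i => if i < m then κ i else κ' (i - m), fun i => if i < m then ε i else ε' (i - m),
    fun i hi => ?_, fun j => ?_⟩
  · dsimp only
    split_ifs with h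
    · exact h1 i h
    · exact h1' (i - m) (by omega)
  · dsimp only
    rw [sum_range_add, h2, h2', mul_sum]
    congr 1
    · refine sum_congr rfl fun i hi => ?_
      simp [mem_range.1 hi]
    · refine sum_congr rfl fun i hi => ?_
      simp only [add_lt_iff_neg_left, not_lt_zero, if_false, add_tsub_cancel_left, mul_ite,
        mul_zero, Nat.cast_add, T_add]
      split_ifs <;> ring

theorem IsTiling.blocks {M : ℕ} {v : ℕ → Fin 4 → ℤ[T;T⁻¹]} (K : ℕ)
    (h : ∀ k < K, IsTiling M (v k)) :
    IsTiling (K * M) (fun j => ∑ k ∈ range K, T ((M : ℤ) * k) * v k j) := by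
  induction K with
  | zero => simpa using IsTiling.zero
  | succ K ih =>
    have := (ih fun k hk => h k (by omega)).append (h K (by omega))
    rw [Nat.succ_mul]
    convert this using 2 with j
    rw [sum_range_succ]
    push_cast
    rw [mul_comm (M : ℤ) K]

theorem IsTiling.of_compl {n : ℕ} {x y : ℕ → ℤ} (h : IsComplSeq n x y) {a b : Fin 4} (hab : a ≠ b)
    {δ δ' : ℤ} (hδ : δ = 1 ∨ δ = -1) (hδ' : δ' = 1 ∨ δ' = -1) :
    IsTiling n (fun j => if j = a then C δ * genFun 1 n x else
      if j = b then C δ' * genFun 1 n y else 0) := by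
  refine ⟨fun i => if y i = 0 then a else b, fun i => δ * x i + δ' * y i, fun i hi => ?_,
    fun j => ?_⟩
  · rcases h i hi with ⟨h0, h1⟩ | ⟨h0, h1⟩ <;> rcases hδ with rfl | rfl <;>
      rcases hδ' with rfl | rfl <;> rcases h1 with h1 | h1 <;> simp [h0, h1]
  · unfold genFun
    simp only [mul_sum]
    split_ifs with h1 h2
    · subst h1
      refine sum_congr rfl fun i hi => ?_
      rcases h i (mem_range.1 hi) with ⟨h0, h1⟩ | ⟨h0, h1⟩
      · simp [h0, mul_assoc]
      · have : y i ≠ 0 := by omega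
        simp [h0, this, hab.symm]
    · subst h2
      refine sum_congr rfl fun i hi => ?_
      rcases h i (mem_range.1 hi) with ⟨h0, h1⟩ | ⟨h0, h1⟩
      · simp [h0, hab]
      · have : y i ≠ 0 := by omega
        simp [h0, this, mul_assoc]
    · refine (sum_eq_zero fun i hi => ?_).symm
      rw [if_neg]
      split_ifs
      · exact Ne.symm h1
      · exact Ne.symm h2

/-- The coefficient pairs `(a, b)` and `(a', b')` are each a unit and a zero, in the same order. -/
def SameUnit (a b a' b' : ℤ) : Prop :=
  (b = 0 ∧ b' = 0 ∧ (a = 1 ∨ a = -1) ∧ (a' = 1 ∨ a' = -1)) ∨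
    (a = 0 ∧ a' = 0 ∧ (b = 1 ∨ b = -1) ∧ (b' = 1 ∨ b' = -1))

theorem IsTiling.slot_fst {n : ℕ} {x y x' y' : ℕ → ℤ} (h : IsComplSeq n x y)
    (h' : IsComplSeq n x' y') {a b a' b' : ℤ} (hs : SameUnit a b a' b') :
    IsTiling n ![C a * genFun 1 n x + C b * genFun 1 n y',
      C a' * genFun 1 n y + C b' * genFun 1 n x', 0, 0] := by
  rcases hs with ⟨rfl, rfl, ha, hb⟩ | ⟨rfl, rfl, ha, hb⟩
  · convert IsTiling.of_compl h (a := 0) (b := 1) (by decide) ha hb using 1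
    ext1 j
    fin_cases j <;> simp
  · convert IsTiling.of_compl h'.symm (a := 0) (b := 1) (by decide) ha hb using 1
    ext1 j
    fin_cases j <;> simp

theorem IsTiling.slot_snd {n : ℕ} {x y x' y' : ℕ → ℤ} (h : IsComplSeq n x y)
    (h' : IsComplSeq n x' y') {a b a' b' : ℤ} (hs : SameUnit a b a' b') :
    IsTiling n ![0, 0, C a * genFun 1 n x + C b * genFun 1 n y',
      C a' * genFun 1 n y + C b' * genFun 1 n x'] := by
  rcases hs with ⟨rfl, rfl, ha, hb⟩ | ⟨rfl, rfl, ha, hb⟩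
  · convert IsTiling.of_compl h (a := 2) (b := 3) (by decide) ha hb using 1
    ext1 j
    fin_cases j <;> simp
  · convert IsTiling.of_compl h'.symm (a := 2) (b := 3) (by decide) ha hb using 1
    ext1 j
    fin_cases j <;> simp

/-- Yang's form of the Lagrange identity. -/
theorem yang_identity {S : Type*} [CommRing S]
    (x x' y y' z z' w w' p p' f f' g g' h h' μ μ' : S) (hμ : μ * μ' = 1) :
    (g * z + h * w + f * x - p * y') * (g' * z' + h' * w' + f' * x' - p' * y)
    + (μ * (g' * w - h' * z) + f * y + p * x') * (μ' * (g * w' - h * z') + f' * y' + p' * x)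
    + (μ * (g' * x - f' * z) - p * w' - h * y) * (μ' * (g * x' - f * z') - p' * w - h' * y')
    + (μ * (h' * x - f' * w) + p * z' + g * y) * (μ' * (h * x' - f * w') + p' * z + g' * y')
    = (x * x' + y * y' + z * z' + w * w') * (p * p' + f * f' + g * g' + h * h') := by
  linear_combination ((g' * w - h' * z) * (g * w' - h * z') + (g' * x - f' * z) * (g * x' - f * z')
     + (h' * x - f' * w) * (h * x' - f * w')) * hμ

theorem T_mul_T_neg (n : ℤ) : (T n : ℤ[T;T⁻¹]) * T (-n) = 1 := by
  rw [← T_add, add_neg_cancel, T_zero]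

theorem yang_norm {v : Fin 4 → ℤ[T;T⁻¹]} {x y z w p f g h : ℤ[T;T⁻¹]} {m e i j : ℤ} {N N' : ℤ}
    (h0 : v 0 = g * z + h * w + T i * f * x - T j * p * invert y)
    (h1 : v 1 = T m * (invert g * w - invert h * z) + T i * f * y + T j * p * invert x)
    (h2 : v 2 = T e * (T m * (invert g * x - T (-i) * invert f * z) - T j * p * invert w - h * y))
    (h3 : v 3 = T e * (T m * (invert h * x - T (-i) * invert f * w) + T j * p * invert z + g * y))
    (hN : x * invert x + y * invert y + z * invert z + w * invert w = C N)
    (hN' : p * invert p + f * invert f + g * invert g + h * invert h = C N') :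
    ∑ k, v k * invert (v k) = C (N * N') := by
  have hi (q : ℤ[T;T⁻¹]) : invert (invert q) = q := involutive_invert q
  have key := yang_identity x (invert x) y (invert y) z (invert z) w (invert w)
    (T j * p) (T (-j) * invert p) (T i * f) (T (-i) * invert f) g (invert g) h (invert h)
    (T m) (T (-m)) (T_mul_T_neg m)
  rw [Fin.sum_univ_four, h0, h1, h2, h3, map_mul LaurentPolynomial.C N N', ← hN, ← hN']
  simp only [map_mul, map_add, map_sub, hi, invert_T, neg_neg]
  linear_combination key +
    ((T m * (invert g * x - T (-i) * invert f * z) - T j * p * invert w - h * y) *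
      (T (-m) * (g * invert x - T i * f * invert z) - T (-j) * invert p * w -
        invert h * invert y) +
     (T m * (invert h * x - T (-i) * invert f * w) + T j * p * invert z + g * y) *
      (T (-m) * (h * invert x - T i * f * invert w) + T (-j) * invert p * z +
        invert g * invert y)) * T_mul_T_neg e +
    (x * invert x + y * invert y + z * invert z + w * invert w) *
      (p * invert p * T_mul_T_neg j + f * invert f * T_mul_T_neg i)

theorem genFun_neg (d : ℤ) (m : ℕ) (X : ℕ → ℤ) :
    genFun d m (fun i => -X i) = -genFun d m X := by
  simp [genFun]

theorem genFun_succ (d : ℤ) (m : ℕ) (X : ℕ → ℤ) :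
    genFun d (m + 1) X = genFun d m X + T (d * m) * C (X m) := by
  rw [genFun, sum_range_succ, genFun, mul_comm (C (X m))]

theorem genFun_succ_left (d : ℤ) (m : ℕ) (X : ℕ → ℤ) :
    genFun d (m + 1) X = C (X 0) + T d * genFun d m (fun k => X (k + 1)) := by
  rw [genFun, sum_range_succ', genFun, mul_sum, add_comm]
  congr 1
  · simp
  · refine sum_congr rfl fun k _ => ?_
    rw [Nat.cast_succ, mul_add, mul_one, T_add]
    ring

theorem sum_T_mul_slots (d : ℤ) (m : ℕ) (a b c e : ℕ → ℤ) (x y z w t : ℤ[T;T⁻¹]) :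
    ∑ k ∈ range m, T (d * k) * (C (a k) * x + C (b k) * y + t * (C (c k) * z + C (e k) * w)) =
      genFun d m a * x + genFun d m b * y + t * (genFun d m c * z + genFun d m e * w) := by
  simp only [genFun, sum_mul, mul_sum, ← sum_add_distrib]
  exact sum_congr rfl fun k _ => by ring

theorem IsComplSeq.sameUnit {n : ℕ} {x y : ℕ → ℤ} (h : IsComplSeq n x y) {i i' : ℕ}
    (hi : i < n) (hi' : i' < n) (hs : x i = 0 ↔ x i' = 0) {a b a' b' : ℤ}
    (ha : a = x i ∨ a = -x i) (hb : b = y i ∨ b = -y i)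
    (ha' : a' = x i' ∨ a' = -x i') (hb' : b' = y i' ∨ b' = -y i') : SameUnit a b a' b' := by
  unfold SameUnit
  have h1 := h i hi
  have h2 := h i' hi'
  omega

/-- Yang multiplication of base sequences of lengths `r`, `s` by halved near-normal sequences. -/
theorem exists_tiling_of_halves {l r s : ℕ} {x y z w P Q P' G H : ℕ → ℤ}
    (hxy : IsComplSeq r x y) (hzw : IsComplSeq s z w)
    (hN : genFun 1 r x * invert (genFun 1 r x) + genFun 1 r y * invert (genFun 1 r y) +
      genFun 1 s z * invert (genFun 1 s z) + genFun 1 s w * invert (genFun 1 s w) =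
      C (r + s : ℤ))
    (hPQ : IsComplSeq (l + 1) P Q) (hPQ' : IsComplSeq (l + 1) P' (fun k => Q (l - k)))
    (hP' : ∀ d, genFun d (l + 1) P' = T (2 * d) * genFun d (l + 1) P)
    (hGH : IsComplSeq l G H) (hG : ∀ k < l, G k = 0 ↔ G (l - 1 - k) = 0)
    (hN' : ∀ d, genFun d (l + 1) P * invert (genFun d (l + 1) P) +
      genFun d (l + 1) Q * invert (genFun d (l + 1) Q) +
      genFun d l G * invert (genFun d l G) + genFun d l H * invert (genFun d l H) =
      C (2 * l + 1 : ℤ)) :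
    ∃ v, IsTiling ((2 * l + 1) * (r + s)) v ∧
      ∑ k, v k * invert (v k) = C ((r + s) * (2 * l + 1) : ℤ) := by
  set Xr := genFun 1 r (fun k => x (r - 1 - k)) with hXr
  set Yr := genFun 1 r (fun k => y (r - 1 - k)) with hYr
  set Zr := genFun 1 s (fun k => z (s - 1 - k)) with hZr
  set Wr := genFun 1 s (fun k => w (s - 1 - k)) with hWr
  set X := genFun 1 r x with hX
  set Y := genFun 1 r y with hY
  set Z := genFun 1 s z with hZ
  set W := genFun 1 s w with hW
  have hxyr := hxy.reverse
  have hzwr := hzw.reverse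
  have t1 : ∀ k < l, IsTiling (s + r) _ := fun k hk =>
    (IsTiling.slot_fst (a := G k) (b := H k) (a' := G (l - 1 - k)) (b' := -H (l - 1 - k)) hzw hzw
      (hGH.sameUnit hk (by omega) (hG k hk) (by simp) (by simp) (by simp) (by simp))).append
    (IsTiling.slot_fst (a := Q k) (b := -P k) (a' := Q k) (b' := P k) hxy hxyr
      (hPQ.symm.sameUnit (i := k) (i' := k) (by omega) (by omega) Iff.rfl
        (by simp) (by simp) (by simp) (by simp)))
  have t2 := (IsTiling.slot_snd (a := -Q l) (b := -P' 0) (a' := -Q l) (b' := P' 0) hzw hzwr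
      (hPQ'.symm.sameUnit (i := 0) (i' := 0) (by omega) (by omega) Iff.rfl
        (by simp) (by simp) (by simp) (by simp))).append
    (IsTiling.slot_fst (a := Q l) (b := -P l) (a' := Q l) (b' := P l) hxy hxyr
      (hPQ.symm.sameUnit (i := l) (i' := l) (by omega) (by omega) Iff.rfl
        (by simp) (by simp) (by simp) (by simp)))
  have t3 : ∀ k < l, IsTiling (s + r) _ := fun k hk =>
    (IsTiling.slot_snd (a := -Q (l - (k + 1))) (b := -P' (k + 1)) (a' := -Q (l - (k + 1)))
      (b' := P' (k + 1)) hzw hzwr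
      (hPQ'.symm.sameUnit (i := k + 1) (i' := k + 1) (by omega) (by omega) Iff.rfl
        (by simp) (by simp) (by simp) (by simp))).append
    (IsTiling.slot_snd (a := G (l - 1 - k)) (b := -H k) (a' := G k) (b' := H (l - 1 - k)) hxy hxy
      (by
        have h1 := hGH k hk
        have h2 := hGH (l - 1 - k) (by omega)
        have h3 := hG k hk
        unfold SameUnit
        omega))
  have t := (IsTiling.blocks l t1).append (t2.append (IsTiling.blocks l t3))
  have hlen : l * (s + r) + ((s + r) + l * (s + r)) = (2 * l + 1) * (r + s) := by ring
  rw [hlen] at t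
  refine ⟨_, t, ?_⟩
  set M : ℤ := ((s + r : ℕ) : ℤ) with hM
  have e : ((l * (s + r) : ℕ) : ℤ) = M * l := by push_cast [hM]; ring
  have hGr := genFun_reverse M l G
  have hHr := genFun_reverse M l H
  have hQr := genFun_reverse M (l + 1) Q
  have hXr' : Xr = _ := genFun_reverse 1 r x
  have hYr' : Yr = _ := genFun_reverse 1 r y
  have hZr' : Zr = _ := genFun_reverse 1 s z
  have hWr' : Wr = _ := genFun_reverse 1 s w
  have hQs := genFun_succ_left M l (fun k => Q (l - k))
  have hPs := genFun_succ_left M l P'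
  rw [hP'] at hPs
  rw [show genFun M (l + 1) (fun k => Q (l - k)) = _ from hQr] at hQs
  have e1 : (T (s + M * (l + 1)) * (T (M * (l - 1)) * T (-s)) : ℤ[T;T⁻¹]) =
      T (M * l) * T (M * ((l + 1 : ℕ) - 1)) := by
    rw [← T_add, ← T_add, ← T_add]
    push_cast
    congr 1
    ring
  have e2 : (T (s + M * (l + 1)) * T (s + 1 * (r - 1)) : ℤ[T;T⁻¹]) =
      T (M * l) * (T (2 * M) * T (1 * (s - 1))) := by
    rw [← T_add, ← T_add, ← T_add]
    push_cast [hM]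
    congr 1
    ring
  have e3 : (T (s + M * (l + 1)) : ℤ[T;T⁻¹]) = T (M * l) * (T M * T s) := by
    rw [← T_add, ← T_add]
    congr 1
    ring
  refine yang_norm (x := X) (y := Y) (z := Z) (w := W) (p := genFun M (l + 1) P)
    (f := genFun M (l + 1) Q) (g := genFun M l G) (h := genFun M l H) (m := M * (l - 1))
    (e := s + M * (l + 1)) (i := s) (j := s + (1 * (r - 1))) ?_ ?_ ?_ ?_ hN (hN' M)
  · change ∑ k ∈ range l, T (M * k) * (C (G k) * Z + C (H k) * W +
        T s * (C (Q k) * X + C (-P k) * Yr)) + T ((l * (s + r) : ℕ) : ℤ) *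
        ((0 + T s * (C (Q l) * X + C (-P l) * Yr)) + T M * ∑ k ∈ range l, T (M * k) *
          (0 + T s * 0)) = _
    rw [sum_T_mul_slots, genFun_neg, genFun_succ, genFun_succ, e, hYr', T_add]
    simp only [mul_zero, add_zero, sum_const_zero, map_neg]
    ring
  · change ∑ k ∈ range l, T (M * k) * (C (G (l - 1 - k)) * W + C (-H (l - 1 - k)) * Z +
        T s * (C (Q k) * Y + C (P k) * Xr)) + T ((l * (s + r) : ℕ) : ℤ) *
        ((0 + T s * (C (Q l) * Y + C (P l) * Xr)) + T M * ∑ k ∈ range l, T (M * k) *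
          (0 + T s * 0)) = _
    rw [sum_T_mul_slots M l (fun k => G (l - 1 - k)) (fun k => -H (l - 1 - k)), genFun_neg,
      hGr, hHr, genFun_succ, genFun_succ, e, hXr', T_add]
    simp only [mul_zero, add_zero, sum_const_zero]
    ring
  · change ∑ k ∈ range l, T (M * k) * (0 + T s * 0) + T ((l * (s + r) : ℕ) : ℤ) *
        ((C (-Q l) * Z + C (-P' 0) * Wr + T s * 0) + T M * ∑ k ∈ range l, T (M * k) *
          (C (-Q (l - (k + 1))) * Z + C (-P' (k + 1)) * Wr + T s * (C (G (l - 1 - k)) * X + C (-H k) * Y))) = _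
    rw [sum_T_mul_slots M l (fun k => -Q (l - (k + 1))) (fun k => -P' (k + 1))
      (fun k => G (l - 1 - k)) (fun k => -H k),
      genFun_neg, genFun_neg, genFun_neg, hGr, e, map_neg, map_neg, hWr']
    simp only [mul_zero, add_zero, sum_const_zero, zero_add]
    linear_combination T (M * l) * Z * hQs + T (M * l) * T (1 * (s - 1)) * invert W * hPs -
      T (M * (l - 1)) * invert (genFun M l G) * X * e3 + genFun M l H * Y * e3 +
      invert (genFun M (l + 1) Q) * Z * e1 + genFun M (l + 1) P * invert W * e2
  · change ∑ k ∈ range l, T (M * k) * (0 + T s * 0) + T ((l * (s + r) : ℕ) : ℤ) *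
        ((C (-Q l) * W + C (P' 0) * Zr + T s * 0) + T M * ∑ k ∈ range l, T (M * k) *
          (C (-Q (l - (k + 1))) * W + C (P' (k + 1)) * Zr + T s * (C (G k) * Y + C (H (l - 1 - k)) * X))) = _
    rw [sum_T_mul_slots M l (fun k => -Q (l - (k + 1))) (fun k => P' (k + 1))
      (fun k => G k) (fun k => H (l - 1 - k)),
      genFun_neg, hHr, e, map_neg, hZr']
    simp only [mul_zero, add_zero, sum_const_zero, zero_add]
    linear_combination T (M * l) * W * hQs - T (M * l) * T (1 * (s - 1)) * invert Z * hPs -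
      T (M * (l - 1)) * invert (genFun M l H) * X * e3 - genFun M l G * Y * e3 +
      invert (genFun M (l + 1) Q) * W * e1 - genFun M (l + 1) P * invert Z * e2

/-- Base sequences of lengths `r`, `s` can be multiplied by `3`. -/
theorem exists_tiling_three {r s : ℕ} {x y z w : ℕ → ℤ}
    (hxy : IsComplSeq r x y) (hzw : IsComplSeq s z w)
    (hN : genFun 1 r x * invert (genFun 1 r x) + genFun 1 r y * invert (genFun 1 r y) +
      genFun 1 s z * invert (genFun 1 s z) + genFun 1 s w * invert (genFun 1 s w) =
      C (r + s : ℤ)) :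
    ∃ v, IsTiling (3 * (r + s)) v ∧ ∑ k, v k * invert (v k) = C ((r + s) * 3 : ℤ) := by
  have hxyr := hxy.reverse
  have hzwr := hzw.reverse
  have u1 : SameUnit 1 0 1 0 := by simp [SameUnit]
  have u2 : SameUnit (-1) 0 (-1) 0 := by simp [SameUnit]
  have u3 : SameUnit 0 (-1) 0 1 := by simp [SameUnit]
  have t := (IsTiling.slot_fst hxy hxyr u1).append ((IsTiling.slot_fst hzw hzwr u1).append
    ((IsTiling.slot_snd hxy hxyr u1).append ((IsTiling.slot_snd hzw hzwr u2).append
    ((IsTiling.slot_fst hxy hxyr u3).append (IsTiling.slot_snd hzw hzwr u3)))))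
  have hlen : r + (s + (r + (s + (r + s)))) = 3 * (r + s) := by ring
  rw [hlen] at t
  refine ⟨_, t, ?_⟩
  rw [genFun_reverse 1 r x, genFun_reverse 1 r y, genFun_reverse 1 s z, genFun_reverse 1 s w]
  set X := genFun 1 r x
  set Y := genFun 1 r y
  set Z := genFun 1 s z
  set W := genFun 1 s w
  have e1 : (T (2 * (r + s) + 1 * (r - 1)) : ℤ[T;T⁻¹]) =
      T r * T s * T r * T s * T (1 * (r - 1)) := by
    simp only [← T_add]
    congr 1
    ring
  have e2 : (T s * T (2 * (r + s) + 1 * (r - 1)) : ℤ[T;T⁻¹]) =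
      T r * T s * T r * T s * T r * T (1 * (s - 1)) := by
    simp only [← T_add]
    congr 1
    ring
  have e3 : (T (2 * r) : ℤ[T;T⁻¹]) = T r * T r := by
    simp only [← T_add]
    congr 1
    ring
  have e4 := T_mul_T_neg (r : ℤ)
  refine yang_norm (x := X) (y := Y) (z := Z) (w := W) (p := 1) (f := 1) (g := T r) (h := 0)
    (m := 2 * r) (e := s) (i := 0) (j := 2 * (r + s) + 1 * (r - 1)) ?_ ?_ ?_ ?_ hN ?_
  · change C 1 * X + C 0 * _ + T r * (C 1 * Z + C 0 * _ + T s * (0 + T r * (0 + T s *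
      (C 0 * _ + C (-1) * (T (1 * (r - 1)) * invert Y) + T r * 0)))) = _
    simp only [map_zero, map_one, map_neg, T_zero]
    linear_combination invert Y * e1
  · change C 1 * Y + C 0 * _ + T r * (C 1 * W + C 0 * _ + T s * (0 + T r * (0 + T s *
      (C 0 * _ + C 1 * (T (1 * (r - 1)) * invert X) + T r * 0)))) = _
    simp only [map_zero, map_one, T_zero, invert_T]
    linear_combination (-invert X) * e1 - W * T r * e4 - T (-r) * W * e3
  · change 0 + T r * (0 + T s * (C 1 * X + C 0 * _ + T r * (C (-1) * Z + C 0 * _ + T s *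
      (0 + T r * (C 0 * _ + C (-1) * (T (1 * (s - 1)) * invert W)))))) = _
    simp only [map_zero, map_one, map_neg, T_zero, invert_T, neg_zero]
    linear_combination invert W * e2 - T s * (T (-r) * X - Z) * e3 - T s * T r * X * e4
  · change 0 + T r * (0 + T s * (C 1 * Y + C 0 * _ + T r * (C (-1) * W + C 0 * _ + T s *
      (0 + T r * (C 0 * _ + C 1 * (T (1 * (s - 1)) * invert Z)))))) = _
    simp only [map_zero, map_one, map_neg, T_zero, neg_zero]
    linear_combination (-invert Z) * e2 + T s * W * e3
  · simp only [map_one, map_zero, invert_T, e4]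
    have : (C 3 : ℤ[T;T⁻¹]) = 3 := map_ofNat _ 3
    rw [this]
    ring

theorem four_dvd_sum_sub_prod (n : ℕ) (u : ℕ → ℤ) (hu : ∀ k < n, u k = 1 ∨ u k = -1) :
    ((∏ k ∈ range n, u k) = 1 ∨ (∏ k ∈ range n, u k) = -1) ∧
      4 ∣ (∑ k ∈ range n, u k) - (∏ k ∈ range n, u k) - n + 1 := by
  induction n with
  | zero => simp
  | succ n ih =>
    obtain ⟨h1, h2⟩ := ih fun k hk => hu k (by omega)
    rw [prod_range_succ, sum_range_succ]
    push_cast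
    rcases h1 with h | h <;> rcases hu n (by omega) with h' | h' <;> rw [h] at h2 ⊢ <;>
      rw [h'] <;> refine ⟨by norm_num, by omega⟩

theorem autocorr_prod_congr {m : ℕ} {A B : ℕ → ℤ} (hA : IsBinarySeq m A) (hB : IsBinarySeq m B)
    (j : ℕ) :
    ((∏ k ∈ range (m - j), (A k * B k) * (A (k + j) * B (k + j))) = 1 ∨
      (∏ k ∈ range (m - j), (A k * B k) * (A (k + j) * B (k + j))) = -1) ∧
    4 ∣ autocorr m A j + autocorr m B j -
      (∏ k ∈ range (m - j), (A k * B k) * (A (k + j) * B (k + j))) - 2 * (m - j : ℕ) + 1 := by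
  have hpm : ∀ (u v : ℤ), (u = 1 ∨ u = -1) → (v = 1 ∨ v = -1) → u * v = 1 ∨ u * v = -1 := by
    rintro u v (rfl | rfl) (rfl | rfl) <;> simp
  obtain ⟨h1, h2⟩ := four_dvd_sum_sub_prod (m - j) (fun k => A k * A (k + j)) fun k hk =>
    hpm _ _ (hA k (by omega)) (hA (k + j) (by omega))
  obtain ⟨h3, h4⟩ := four_dvd_sum_sub_prod (m - j) (fun k => B k * B (k + j)) fun k hk =>
    hpm _ _ (hB k (by omega)) (hB (k + j) (by omega))
  have e : (∏ k ∈ range (m - j), (A k * B k) * (A (k + j) * B (k + j))) =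
      (∏ k ∈ range (m - j), A k * A (k + j)) * ∏ k ∈ range (m - j), B k * B (k + j) := by
    rw [← prod_mul_distrib]
    exact prod_congr rfl fun k _ => by ring
  rw [e]
  unfold autocorr
  refine ⟨hpm _ _ h1 h3, ?_⟩
  rcases h1 with h | h <;> rcases h3 with h' | h' <;> rw [h] at h2 ⊢ <;> rw [h'] at h4 ⊢ <;> omega

/-- The products of the entries entering the autocorrelations of base sequences. -/
theorem IsBaseSeq.prod_eq_neg_one {l : ℕ} {A B C D : ℕ → ℤ} (h : IsBaseSeq (l + 1) l A B C D)
    {j : ℕ} (hj : 1 ≤ j) (hjl : j ≤ l) :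
    (∏ k ∈ range (l + 1 - j), (A k * B k) * (A (k + j) * B (k + j))) *
      (∏ k ∈ range (l - j), (C k * D k) * (C (k + j) * D (k + j))) = -1 := by
  obtain ⟨hA, hB, hC, hD, h0⟩ := h
  obtain ⟨h1, h2⟩ := autocorr_prod_congr hA hB j
  obtain ⟨h3, h4⟩ := autocorr_prod_congr hC hD j
  have := h0 j hj
  rcases h1 with h | h <;> rcases h3 with h' | h' <;> rw [h] at h2 ⊢ <;> rw [h'] at h4 ⊢ <;> omega

theorem IsBaseSeq.prod_symm_eq_neg_one {l : ℕ} {A B C D : ℕ → ℤ}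
    (h : IsBaseSeq (l + 1) l A B C D) {n : ℕ} (hn : n < l) :
    (∏ k ∈ range (n + 1), (A k * B k) * (A (l - k) * B (l - k))) *
      (∏ k ∈ range n, (C k * D k) * (C (l - 1 - k) * D (l - 1 - k))) = -1 := by
  rw [← h.prod_eq_neg_one (j := l - n) (by omega) (by omega)]
  have e1 : l + 1 - (l - n) = n + 1 := by omega
  have e2 : l - (l - n) = n := by omega
  rw [e1, e2]
  simp only [prod_mul_distrib]
  congr 2
  · rw [← prod_range_reflect (fun k => A (k + (l - n))),
      ← prod_range_reflect (fun k => B (k + (l - n)))]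
    congr 1 <;> refine prod_congr rfl fun k hk => ?_ <;> rw [mem_range] at hk <;> congr 1 <;> omega
  · rw [← prod_range_reflect (fun k => C (k + (l - n))),
      ← prod_range_reflect (fun k => D (k + (l - n)))]
    congr 1 <;> refine prod_congr rfl fun k hk => ?_ <;> rw [mem_range] at hk <;> congr 1 <;> omega

/-- Near-normal sequences of length at least two have even length, opposite last entries of the
first two sequences, and a symmetric product of the last two sequences. -/
theorem IsNearNormalSeq.symmetry {l : ℕ} {A B C D : ℕ → ℤ} (h : IsNearNormalSeq l A B C D)
    (hl : 2 ≤ l) :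
    Even l ∧ A l * B l = -1 ∧ ∀ i < l, C i * D i = C (l - 1 - i) * D (l - 1 - i) := by
  obtain ⟨hb, hAB⟩ := h
  have hA : ∀ i < l, A i * B i = (-1) ^ i := fun i hi => by
    rw [hAB i hi]
    rcases hb.1 i (by omega) with h | h <;> simp [h]
  have hpm : ∀ i < l, C i * D i = 1 ∨ C i * D i = -1 := fun i hi => by
    rcases hb.2.2.1 i hi with h | h <;> rcases hb.2.2.2.1 i hi with h' | h' <;> simp [h, h']
  have key : ∀ n, n + 2 ≤ l → (C n * D n) * (C (l - 1 - n) * D (l - 1 - n)) = (-1) ^ l := by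
    intro n hn
    have h1 := hb.prod_symm_eq_neg_one (n := n) (by omega)
    have h2 := hb.prod_symm_eq_neg_one (n := n + 1) (by omega)
    rw [prod_range_succ _ (n + 1),
      prod_range_succ (fun k => (C k * D k) * (C (l - 1 - k) * D (l - 1 - k))) n, hA (n + 1) (by omega),
      hA (l - (n + 1)) (by omega), ← pow_add, show n + 1 + (l - (n + 1)) = l by omega] at h2
    have h3 : ((-1 : ℤ) ^ l) * ((-1) ^ l) = 1 := by rw [← mul_pow]; simp
    linear_combination -(-1) ^ l * h2 + (-1) ^ l * (-1) ^ l * (C n * D n) *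
      (C (l - 1 - n) * D (l - 1 - n)) * h1 - (C n * D n) * (C (l - 1 - n) * D (l - 1 - n)) * h3
  have he : Even l := by
    by_contra ho
    rw [Nat.not_even_iff_odd] at ho
    obtain ⟨k, rfl⟩ := ho
    have := key k (by omega)
    rw [show 2 * k + 1 - 1 - k = k by omega, Odd.neg_one_pow ⟨k, rfl⟩] at this
    nlinarith [mul_self_nonneg (C k * D k)]
  refine ⟨he, ?_, fun i hi => ?_⟩
  · have := hb.prod_symm_eq_neg_one (n := 0) (by omega)
    simpa [hA 0 (by omega)] using this
  · have hk : (C i * D i) * (C (l - 1 - i) * D (l - 1 - i)) = 1 := by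
      by_cases h' : i + 2 ≤ l
      · rw [key i h', he.neg_one_pow]
      · have := key 0 hl
        rw [he.neg_one_pow] at this
        have e : i = l - 1 := by omega
        subst e
        simp only [Nat.sub_zero, Nat.sub_self] at this ⊢
        rw [← this, mul_comm]
    rcases hpm i hi with h | h <;> rw [h] at hk ⊢ <;> omega

theorem IsNearNormalSeq.exists_tiling {l r s : ℕ} {A B C D x y z w : ℕ → ℤ}
    (h : IsNearNormalSeq l A B C D) (hxy : IsComplSeq r x y) (hzw : IsComplSeq s z w)
    (hN : genFun 1 r x * invert (genFun 1 r x) + genFun 1 r y * invert (genFun 1 r y) +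
      genFun 1 s z * invert (genFun 1 s z) + genFun 1 s w * invert (genFun 1 s w) =
      LaurentPolynomial.C (r + s : ℤ)) :
    ∃ v, IsTiling ((2 * l + 1) * (r + s)) v ∧
      ∑ k, v k * invert (v k) = LaurentPolynomial.C ((r + s) * (2 * l + 1) : ℤ) := by
  rcases Nat.lt_or_ge l 2 with hl | hl
  · interval_cases l
    · refine exists_tiling_of_halves (l := 0) (P := fun _ => 0) (Q := fun _ => 1)
        (P' := fun _ => 0) (G := fun _ => 0) (H := fun _ => 0) hxy hzw hN ?_ ?_ ?_ ?_ ?_ ?_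
      all_goals simp [IsComplSeq, genFun]
    · simpa using exists_tiling_three hxy hzw hN
  obtain ⟨he, hlast, hsymm⟩ := h.symmetry hl
  obtain ⟨P, Q, G, H, hPQ, hGH, hA, hB, hC, hD, hn⟩ := h.1.exists_compl
  have hAB := h.2
  have hP : ∀ k < l, P k = 0 ↔ Odd k := fun k hk => by
    have h1 := hAB k hk
    rw [hA k (by omega), hB k (by omega)] at h1
    have h2 := hPQ k (by omega)
    rcases Nat.even_or_odd k with hk' | hk'
    · rw [hk'.neg_one_pow] at h1
      have := Nat.not_odd_iff_even.2 hk'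
      simp only [this, iff_false]
      omega
    · rw [hk'.neg_one_pow] at h1
      simp only [hk', iff_true]
      omega
  have hPl : P l = 0 := by
    rw [hA l (by omega), hB l (by omega)] at hlast
    have h2 := hPQ l (by omega)
    rcases h2 with ⟨h0, h1 | h1⟩ | ⟨h0, h1⟩
    · simp [h0, h1] at hlast
    · simp [h0, h1] at hlast
    · exact h0
  have hPl' : P (l - 1) = 0 := (hP (l - 1) (by omega)).2 (Nat.Even.sub_odd (by omega) he odd_one)
  refine exists_tiling_of_halves (P := P) (Q := Q) (P' := fun k => if k < 2 then 0 else P (k - 2))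
    (G := G) (H := H) hxy hzw hN hPQ ?_ ?_ hGH ?_ ?_
  · intro k hk
    dsimp only
    have h0 := hPQ (l - k) (by omega)
    split_ifs with h2
    · have : P (l - k) = 0 := by
        rcases Nat.lt_or_ge k 1 with h | h
        · rwa [show l - k = l by omega]
        · rwa [show l - k = l - 1 by omega]
      omega
    · have h1 := hPQ (k - 2) (by omega)
      have h3 := hP (k - 2) (by omega)
      have h4 := hP (l - k) (by omega)
      have h5 : Odd (k - 2) ↔ Odd (l - k) := by
        rw [Nat.odd_sub (by omega), Nat.odd_sub (by omega)]
        simp [he, ← Nat.not_even_iff_odd]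
      rw [h5, ← h4] at h3
      omega
  · intro d
    obtain ⟨m, rfl⟩ : ∃ m, l = m + 1 := ⟨l - 1, by omega⟩
    rw [genFun_succ_left, genFun_succ_left, genFun_succ, genFun_succ, hPl,
      show P m = 0 from hPl', two_mul, T_add]
    simp [mul_assoc]
  · intro k hk
    have h1 := hsymm k hk
    have h2 := hGH k hk
    have h3 := hGH (l - 1 - k) (by omega)
    rw [hC k hk, hD k hk, hC _ (by omega), hD (l - 1 - k) (by omega)] at h1
    rcases h2 with ⟨a, b | b⟩ | ⟨a, b | b⟩ <;> rcases h3 with ⟨a', b' | b'⟩ | ⟨a', b' | b'⟩ <;>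
      simp [a, b, a', b'] at h1 ⊢
  · intro d
    rw [hn d]
    congr 1
    push_cast
    ring

section Circulant

variable (t : ℕ)

/-- The cyclic shift by `n` as a permutation matrix. -/
def shiftMatrix (n : ℤ) : Matrix (ZMod t) (ZMod t) ℤ :=
  Matrix.of fun i j => if j = i + n then 1 else 0

/-- The back-diagonal permutation matrix. -/
def backMatrix : Matrix (ZMod t) (ZMod t) ℤ :=
  Matrix.of fun i j => if i + j = 0 then 1 else 0

theorem backMatrix_transpose : (backMatrix t)ᵀ = backMatrix t := by
  ext i j
  simp [backMatrix, add_comm]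

variable [NeZero t]

/-- Cyclic shifts as a monoid homomorphism. -/
def shiftHom : Multiplicative ℤ →* Matrix (ZMod t) (ZMod t) ℤ where
  toFun n := shiftMatrix t n.toAdd
  map_one' := by
    ext i j
    simp [shiftMatrix, Matrix.one_apply, eq_comm]
  map_mul' m n := by
    ext i j
    simp only [shiftMatrix, Matrix.mul_apply, Matrix.of_apply, toAdd_mul, Int.cast_add, ite_mul,
      one_mul, zero_mul, sum_ite_eq', mem_univ, if_true, add_assoc]

/-- The circulant matrix with first row given by a Laurent polynomial modulo `T ^ t - 1`. -/
noncomputable def circulantHom : ℤ[T;T⁻¹] →ₐ[ℤ] Matrix (ZMod t) (ZMod t) ℤ :=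
  AddMonoidAlgebra.lift ℤ _ ℤ (shiftHom t)

theorem circulantHom_C_mul_T (a n : ℤ) :
    circulantHom t (C a * T n) = a • shiftMatrix t n := by
  rw [← single_eq_C_mul_T, circulantHom, AddMonoidAlgebra.lift_single]
  rfl

theorem circulantHom_C (a : ℤ) : circulantHom t (C a) = a • 1 := by
  have := circulantHom_C_mul_T t a 0
  rw [T_zero, mul_one] at this
  rw [this]
  congr 1
  exact map_one (shiftHom t)

theorem circulantHom_invert (x : ℤ[T;T⁻¹]) :
    circulantHom t (invert x) = (circulantHom t x)ᵀ := by
  induction x using LaurentPolynomial.induction_on' with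
  | add p q hp hq => rw [map_add, map_add, hp, hq, map_add, Matrix.transpose_add]
  | C_mul_T n a =>
    rw [map_mul, invert_C, invert_T, circulantHom_C_mul_T, circulantHom_C_mul_T,
      Matrix.transpose_smul]
    congr 1
    ext i j
    simp only [shiftMatrix, Matrix.of_apply, Matrix.transpose_apply]
    congr 1
    rw [Int.cast_neg, ← sub_eq_add_neg, eq_sub_iff_add_eq]
    exact propext eq_comm

theorem mul_backMatrix_apply (A : Matrix (ZMod t) (ZMod t) ℤ) (i j : ZMod t) :
    (A * backMatrix t) i j = A i (-j) := by
  simp [Matrix.mul_apply, backMatrix, add_eq_zero_iff_eq_neg]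

theorem backMatrix_mul_apply (A : Matrix (ZMod t) (ZMod t) ℤ) (i j : ZMod t) :
    (backMatrix t * A) i j = A (-i) j := by
  simp [Matrix.mul_apply, backMatrix, add_eq_zero_iff_eq_neg']

theorem backMatrix_mul_self : backMatrix t * backMatrix t = 1 := by
  ext i j
  rw [mul_backMatrix_apply]
  simp [backMatrix, Matrix.one_apply, ← sub_eq_add_neg, sub_eq_zero]

theorem backMatrix_mul_circulantHom (x : ℤ[T;T⁻¹]) :
    backMatrix t * circulantHom t x = circulantHom t (invert x) * backMatrix t := by
  rw [circulantHom_invert]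
  ext i j
  rw [mul_backMatrix_apply, backMatrix_mul_apply, Matrix.transpose_apply]
  induction x using LaurentPolynomial.induction_on' with
  | add p q hp hq => simp only [map_add, Matrix.add_apply, hp, hq]
  | C_mul_T n a =>
    simp only [circulantHom_C_mul_T, Matrix.smul_apply, shiftMatrix, Matrix.of_apply]
    congr 2
    exact propext ⟨fun h => by rw [h]; ring, fun h => by rw [h]; ring⟩

/-- The combination `X + Y R` of circulant matrices `X`, `Y`, with `R` the back-diagonal matrix. -/
noncomputable def pairMatrix : ℤ[T;T⁻¹] × ℤ[T;T⁻¹] →+ Matrix (ZMod t) (ZMod t) ℤ where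
  toFun p := circulantHom t p.1 + circulantHom t p.2 * backMatrix t
  map_zero' := by simp
  map_add' p q := by
    simp only [Prod.fst_add, Prod.snd_add, map_add, add_mul]
    abel

theorem pairMatrix_C (a : ℤ) : pairMatrix t (C a, 0) = a • 1 := by
  simp only [pairMatrix, AddMonoidHom.coe_mk, ZeroHom.coe_mk, circulantHom_C, map_zero, zero_mul,
    add_zero]

end Circulant

/-- The product on pairs of Laurent polynomials that corresponds to
`(X + Y R) * (X' + Y' R)ᵀ`. -/
noncomputable def pairMul (p q : ℤ[T;T⁻¹] × ℤ[T;T⁻¹]) : ℤ[T;T⁻¹] × ℤ[T;T⁻¹] :=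
  (p.1 * invert q.1 + p.2 * invert q.2, p.1 * q.2 + p.2 * q.1)

theorem pairMatrix_mul_transpose (t : ℕ) [NeZero t] (p q : ℤ[T;T⁻¹] × ℤ[T;T⁻¹]) :
    pairMatrix t p * (pairMatrix t q)ᵀ = pairMatrix t (pairMul p q) := by
  have h1 : circulantHom t p.1 * (backMatrix t * circulantHom t (invert q.2)) =
      circulantHom t p.1 * circulantHom t q.2 * backMatrix t := by
    rw [backMatrix_mul_circulantHom, mul_assoc, involutive_invert]
  have h2 : circulantHom t p.2 * backMatrix t * circulantHom t (invert q.1) =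
      circulantHom t p.2 * circulantHom t q.1 * backMatrix t := by
    rw [mul_assoc, backMatrix_mul_circulantHom, mul_assoc, involutive_invert]
  have h3 : circulantHom t p.2 * backMatrix t * (backMatrix t * circulantHom t (invert q.2)) =
      circulantHom t p.2 * circulantHom t (invert q.2) := by
    rw [mul_assoc, ← mul_assoc (backMatrix t), backMatrix_mul_self, one_mul]
  simp only [pairMatrix, pairMul, AddMonoidHom.coe_mk, ZeroHom.coe_mk, Matrix.transpose_add,
    Matrix.transpose_mul, backMatrix_transpose, ← circulantHom_invert, map_add, map_mul,
    mul_add, add_mul, h1, h2, h3]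
  abel

/-- The Goethals–Seidel array. -/
noncomputable def gsArray (a : Fin 4 → ℤ[T;T⁻¹]) : Fin 4 → Fin 4 → ℤ[T;T⁻¹] × ℤ[T;T⁻¹] :=
  ![![(a 0, 0), (0, a 1), (0, a 2), (0, a 3)],
    ![(0, -a 1), (a 0, 0), (0, invert (a 3)), (0, -invert (a 2))],
    ![(0, -a 2), (0, -invert (a 3)), (a 0, 0), (0, invert (a 1))],
    ![(0, -a 3), (0, invert (a 2)), (0, -invert (a 1)), (a 0, 0)]]

theorem gsArray_polarized (a b : Fin 4 → ℤ[T;T⁻¹]) (i j : Fin 4) :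
    ∑ m, (pairMul (gsArray a i m) (gsArray b j m) + pairMul (gsArray b i m) (gsArray a j m)) =
      if i = j then (∑ m, (a m * invert (b m) + b m * invert (a m)), 0) else 0 := by
  have hi (q : ℤ[T;T⁻¹]) : invert (invert q) = q := involutive_invert q
  rw [Fin.sum_univ_four, Fin.sum_univ_four]
  ext1 <;> fin_cases i <;> fin_cases j <;> simp [gsArray, pairMul, hi] <;> ring

/-- Four signed permutations of a quadruple whose inner products with involution are skew. -/
noncomputable def signedPerm (v : Fin 4 → ℤ[T;T⁻¹]) : Fin 4 → Fin 4 → ℤ[T;T⁻¹] :=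
  ![![v 0, v 1, v 2, v 3], ![v 1, -v 0, v 3, -v 2], ![v 2, -v 3, -v 0, v 1],
    ![v 3, v 2, -v 1, -v 0]]

theorem signedPerm_polarized (v : Fin 4 → ℤ[T;T⁻¹]) (k l : Fin 4) :
    ∑ m, (signedPerm v k m * invert (signedPerm v l m) +
      signedPerm v l m * invert (signedPerm v k m)) =
      if k = l then 2 * ∑ m, v m * invert (v m) else 0 := by
  rw [Fin.sum_univ_four, Fin.sum_univ_four]
  fin_cases k <;> fin_cases l <;> simp [signedPerm] <;> ring

theorem IsTiling.circulantHom_apply {t : ℕ} [NeZero t] {v : Fin 4 → ℤ[T;T⁻¹]} (h : IsTiling t v)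
    (i j : ZMod t) : ∃ κ : Fin 4, ∃ ε : ℤ, (ε = 1 ∨ ε = -1) ∧
      ∀ m, circulantHom t (v m) i j = if κ = m then ε else 0 := by
  obtain ⟨κ, ε, h1, h2⟩ := h
  have hlt := ZMod.val_lt (j - i)
  refine ⟨κ (j - i).val, ε (j - i).val, h1 _ hlt, fun m => ?_⟩
  rw [h2, map_sum, Matrix.sum_apply, sum_eq_single (j - i).val]
  · split_ifs
    · rw [circulantHom_C_mul_T]
      simp [shiftMatrix]
    · simp
  · intro n hn hne
    rw [mem_range] at hn
    split_ifs
    · rw [circulantHom_C_mul_T]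
      have : j ≠ i + (n : ZMod t) := by
        rintro rfl
        rw [add_sub_cancel_left, ZMod.val_natCast_of_lt hn] at hne
        exact hne rfl
      simp [shiftMatrix, this]
    · simp
  · intro hn
    exact absurd (mem_range.2 hlt) hn

/-- The Goethals–Seidel array of circulant matrices on the `k`-th signed permutation of `v`. -/
noncomputable def designMatrix (t : ℕ) [NeZero t] (v : Fin 4 → ℤ[T;T⁻¹]) (k : Fin 4) :
    Matrix (Fin 4 × ZMod t) (Fin 4 × ZMod t) ℤ :=
  Matrix.of fun i j => pairMatrix t (gsArray (signedPerm v k) i.1 j.1) i.2 j.2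

theorem designMatrix_mul_transpose_apply (t : ℕ) [NeZero t] (v : Fin 4 → ℤ[T;T⁻¹]) (k l : Fin 4)
    (i j : Fin 4 × ZMod t) : (designMatrix t v k * (designMatrix t v l)ᵀ) i j =
      pairMatrix t (∑ m, pairMul (gsArray (signedPerm v k) i.1 m)
        (gsArray (signedPerm v l) j.1 m)) i.2 j.2 := by
  rw [map_sum, Matrix.sum_apply, Matrix.mul_apply, Fintype.sum_prod_type]
  refine sum_congr rfl fun m _ => ?_
  rw [← pairMatrix_mul_transpose]
  rfl

theorem designMatrix_polarized {t : ℕ} [NeZero t] {v : Fin 4 → ℤ[T;T⁻¹]} {N : ℤ}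
    (hv : ∑ k, v k * invert (v k) = C N) (k l : Fin 4) :
    designMatrix t v k * (designMatrix t v l)ᵀ + designMatrix t v l * (designMatrix t v k)ᵀ =
      if k = l then (2 * N) • 1 else 0 := by
  ext i j
  rw [Matrix.add_apply, designMatrix_mul_transpose_apply, designMatrix_mul_transpose_apply,
    ← Matrix.add_apply, ← map_add, ← sum_add_distrib, gsArray_polarized, signedPerm_polarized, hv]
  have h2 : (2 * C N : ℤ[T;T⁻¹]) = C (2 * N) := by
    rw [map_mul]
    congr 1
  rw [h2]
  obtain ⟨i, a⟩ := i
  obtain ⟨j, b⟩ := j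
  by_cases hij : i = j
  · by_cases hkl : k = l
    · rw [if_pos hij, if_pos hkl, if_pos hkl, pairMatrix_C]
      simp [hij, Matrix.one_apply]
    · rw [if_neg hkl, if_neg hkl, if_pos hij, ← Prod.zero_eq_mk, map_zero]
      simp
  · rw [if_neg hij, map_zero]
    split_ifs <;> simp [hij]

theorem IsTiling.designMatrix_apply {t : ℕ} [NeZero t] {v : Fin 4 → ℤ[T;T⁻¹]} (h : IsTiling t v)
    (u : Fin 4 → ℤ) (hu : ∀ k, u k = 1 ∨ u k = -1) (i j : Fin 4 × ZMod t) :
    (∑ k, designMatrix t v k i j * u k) = 1 ∨ (∑ k, designMatrix t v k i j * u k) = -1 := by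
  obtain ⟨i, a⟩ := i
  obtain ⟨j, b⟩ := j
  obtain ⟨κ₁, ε₁, hε₁, h₁⟩ := h.circulantHom_apply a b
  obtain ⟨κ₂, ε₂, hε₂, h₂⟩ := h.circulantHom_apply a (-b)
  obtain ⟨κ₃, ε₃, hε₃, h₃⟩ := h.circulantHom_apply (-b) a
  have pm (ε : ℤ) (hε : ε = 1 ∨ ε = -1) : ∀ k, ε * u k = 1 ∨ ε * u k = -1 := fun k => by
    rcases hε with rfl | rfl <;> rcases hu k with h | h <;> simp [h]
  replace hε₁ := pm ε₁ hε₁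
  replace hε₂ := pm ε₂ hε₂
  replace hε₃ := pm ε₃ hε₃
  rw [Fin.sum_univ_four]
  simp only [designMatrix, Matrix.of_apply, pairMatrix, AddMonoidHom.coe_mk, ZeroHom.coe_mk,
    Matrix.add_apply, mul_backMatrix_apply]
  fin_cases i <;> fin_cases j <;>
    simp [gsArray, signedPerm, circulantHom_invert, h₁, h₂, h₃] <;>
    clear h₁ h₂ h₃ <;>
    first
    | (fin_cases κ₁ <;> simp <;> grind)
    | (fin_cases κ₂ <;> simp <;> grind)
    | (fin_cases κ₃ <;> simp <;> grind)

/-- Plugging amicable Williamson-type matrices into an orthogonal design. -/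
theorem sum_kronecker_mul_transpose {n : Type*} [Fintype n] [DecidableEq n] {w : ℕ} {N : ℤ}
    {D : Fin 4 → Matrix n n ℤ} {W : Fin 4 → Matrix (Fin w) (Fin w) ℤ}
    (hD : ∀ k l, D k * (D l)ᵀ + D l * (D k)ᵀ = if k = l then (2 * N) • 1 else 0)
    (hW : IsWilliamsonType w W) :
    (∑ k, D k ⊗ₖ W k) * (∑ k, D k ⊗ₖ W k)ᵀ = (N * (4 * w : ℕ)) • 1 := by
  have h1 : (∑ k, D k ⊗ₖ W k) * (∑ k, D k ⊗ₖ W k)ᵀ =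
      ∑ k, ∑ l, (D k * (D l)ᵀ) ⊗ₖ (W k * (W l)ᵀ) := by
    rw [Matrix.transpose_sum, sum_mul_sum]
    refine sum_congr rfl fun k _ => sum_congr rfl fun l _ => ?_
    rw [Matrix.mul_kronecker_mul]
    rfl
  have h2 : (∑ k, D k ⊗ₖ W k) * (∑ k, D k ⊗ₖ W k)ᵀ =
      ∑ k, ∑ l, (D l * (D k)ᵀ) ⊗ₖ (W k * (W l)ᵀ) := by
    rw [h1, sum_comm]
    refine sum_congr rfl fun k _ => sum_congr rfl fun l _ => ?_
    rw [hW.2.1 k l]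
  have h3 : (2 : ℤ) • ((∑ k, D k ⊗ₖ W k) * (∑ k, D k ⊗ₖ W k)ᵀ) =
      (2 : ℤ) • (N * (4 * w : ℕ)) • (1 : Matrix (n × Fin w) (n × Fin w) ℤ) := by
    rw [two_smul]
    nth_rw 1 [h1]
    rw [h2]
    simp only [← sum_add_distrib, ← Matrix.add_kronecker, hD]
    have h4 : ∀ k, ∑ l, (if k = l then (2 * N) • (1 : Matrix n n ℤ) else 0) ⊗ₖ (W k * (W l)ᵀ) =
        (2 * N) • ((1 : Matrix n n ℤ) ⊗ₖ (W k * (W k)ᵀ)) := fun k => by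
      rw [sum_eq_single k]
      · rw [if_pos rfl, Matrix.smul_kronecker]
      · intro l _ hl
        rw [if_neg hl.symm, Matrix.zero_kronecker]
      · simp
    simp only [h4, ← smul_sum]
    have h5 : ∑ k, (1 : Matrix n n ℤ) ⊗ₖ (W k * (W k)ᵀ) =
        (1 : Matrix n n ℤ) ⊗ₖ ∑ k, W k * (W k)ᵀ := by
      simp only [Fin.sum_univ_four, Matrix.kronecker_add]
    rw [h5, hW.2.2, Matrix.kronecker_smul, Matrix.one_kronecker_one, smul_smul, smul_smul,
      mul_assoc]
  exact smul_right_injective _ two_ne_zero h3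

theorem IsHadamardMatrix.reindex {m n : Type*} [Fintype m] [DecidableEq m] [Fintype n]
    [DecidableEq n] {H : Matrix m m ℤ} (hH : IsHadamardMatrix H) (e : m ≃ n) :
    IsHadamardMatrix (Matrix.reindex e e H) := by
  refine ⟨fun i j => hH.1 _ _, ?_⟩
  rw [Matrix.transpose_reindex, Matrix.reindex_apply, Matrix.reindex_apply,
    Matrix.submatrix_mul_equiv, hH.2, Fintype.card_congr e]
  rw [Matrix.submatrix_smul, Pi.smul_apply, Pi.smul_apply, Matrix.submatrix_one_equiv]

theorem IsTiling.isHadamardMatrix {t w : ℕ} [NeZero t] {v : Fin 4 → ℤ[T;T⁻¹]} (h : IsTiling t v)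
    (hv : ∑ k, v k * invert (v k) = C (t : ℤ)) {W : Fin 4 → Matrix (Fin w) (Fin w) ℤ}
    (hW : IsWilliamsonType w W) :
    IsHadamardMatrix (∑ k, designMatrix t v k ⊗ₖ W k) := by
  refine ⟨fun i j => ?_, ?_⟩
  · simp only [Matrix.sum_apply, Matrix.kroneckerMap_apply]
    exact h.designMatrix_apply (fun k => W k i.2 j.2) (fun k => hW.1 k _ _) i.1 j.1
  · rw [sum_kronecker_mul_transpose (designMatrix_polarized hv) hW]
    congr 1
    simp [ZMod.card]
    ring

/-- If `NN(l)`, `BS(r,s)` and Williamson-type matrices of order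
`w` exist, then a Hadamard matrix of order `4(2l+1)(r+s)w` exists. -/
theorem near_normal_base_williamson_to_hadamard (l r s w : ℕ)
    (hNN : ∃ A B C D : ℕ → ℤ, IsNearNormalSeq l A B C D)
    (hBS : ∃ A B C D : ℕ → ℤ, IsBaseSeq r s A B C D)
    (hWT : ∃ W : Fin 4 → Matrix (Fin w) (Fin w) ℤ, IsWilliamsonType w W) :
    ∃ H : Matrix (Fin (4 * (2 * l + 1) * (r + s) * w))
        (Fin (4 * (2 * l + 1) * (r + s) * w)) ℤ,
      IsHadamardMatrix H := by
  obtain ⟨A, B, C, D, hAB⟩ := hNN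
  obtain ⟨A', B', C', D', hbase⟩ := hBS
  obtain ⟨W, hW⟩ := hWT
  obtain ⟨x, y, z, u, hxy, hzu, -, -, -, -, hN⟩ := hbase.exists_compl
  obtain ⟨v, hv, hvN⟩ := hAB.exists_tiling hxy hzu (hN 1)
  rcases Nat.eq_zero_or_pos (r + s) with h0 | hpos
  · have hz : 4 * (2 * l + 1) * (r + s) * w = 0 := by rw [h0]; simp
    rw [hz]
    exact ⟨1, fun i => i.elim0, Subsingleton.elim _ _⟩
  · have : NeZero ((2 * l + 1) * (r + s)) := ⟨by positivity⟩
    have hvt : ∑ k, v k * LaurentPolynomial.invert (v k) =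
        LaurentPolynomial.C (((2 * l + 1) * (r + s) : ℕ) : ℤ) := by
      rw [hvN]
      push_cast
      rw [mul_comm]
    have hcard : Fintype.card ((Fin 4 × ZMod ((2 * l + 1) * (r + s))) × Fin w) =
        4 * (2 * l + 1) * (r + s) * w := by
      simp only [Fintype.card_prod, Fintype.card_fin, ZMod.card]
      ring
    exact ⟨_, (hv.isHadamardMatrix hvt hW).reindex (Fintype.equivFinOfCardEq hcard)⟩
end

section
/- There exists a Hadamard matrix of order 764 = 4·191. -/
open Finset Matrix Kronecker

/-- The periodic autocorrelation `∑ₖ x(k) x(k + s)` of a function on a finite abelian group. -/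
def periodicAutocorr {G : Type*} [AddCommGroup G] [Fintype G] (x : G → ℤ) (s : G) : ℤ :=
  ∑ k, x k * x (k + s)

/-- The Goethals–Seidel array of four functions on an abelian group. -/
def goethalsSeidel {G : Type*} [AddCommGroup G] (a b c d : G → ℤ) :
    Matrix (Fin 4 × G) (Fin 4 × G) ℤ :=
  fun p q =>
    let i := p.2
    let j := q.2
    (!![a (j - i), b (-i - j), c (-i - j), d (-i - j);
       -b (-i - j), a (j - i), d (i + j), -c (i + j);
       -c (-i - j), -d (i + j), a (j - i), b (i + j);
       -d (-i - j), c (i + j), -b (i + j), a (j - i)] : Matrix (Fin 4) (Fin 4) ℤ) p.1 q.1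

section
variable {G : Type*} [AddCommGroup G] [Fintype G] (f g : G → ℤ) (i j : G)

theorem sum_sub_mul_sub : ∑ k, f (k - i) * f (k - j) = periodicAutocorr f (i - j) :=
  Fintype.sum_equiv (Equiv.subRight i) _ _ fun k => by
    simp

theorem sum_add_mul_add : ∑ k, f (i + k) * f (j + k) = periodicAutocorr f (i - j) := by
  refine Fintype.sum_equiv (Equiv.addLeft j) _ _ fun k => ?_
  simp only [Equiv.coe_addLeft]
  rw [mul_comm]; congr 2; abel

theorem sum_neg_sub_mul_neg_sub :
    ∑ k, f (-i - k) * g (-j - k) = ∑ k, g (i + k) * f (j + k) := by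
  refine Fintype.sum_equiv (Equiv.subLeft (-i - j)) _ _ fun k => ?_
  simp only [Equiv.subLeft_apply]
  rw [mul_comm]; congr 2 <;> abel

theorem sum_sub_mul_neg_sub :
    ∑ k, f (k - i) * g (-j - k) = ∑ k, g (-i - k) * f (k - j) := by
  refine Fintype.sum_equiv (Equiv.addRight (j - i)) _ _ fun k => ?_
  simp only [Equiv.coe_addRight]
  rw [mul_comm]; congr 2 <;> abel

theorem sum_neg_sub_mul_add :
    ∑ k, f (-i - k) * g (j + k) = ∑ k, g (-i - k) * f (j + k) := by
  refine Fintype.sum_equiv (Equiv.subLeft (-i - j)) _ _ fun k => ?_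
  simp only [Equiv.subLeft_apply]
  rw [mul_comm]; congr 2 <;> abel

theorem sum_add_mul_neg_sub :
    ∑ k, f (i + k) * g (-j - k) = ∑ k, g (i + k) * f (-j - k) := by
  refine Fintype.sum_equiv (Equiv.subLeft (-i - j)) _ _ fun k => ?_
  simp only [Equiv.subLeft_apply]
  rw [mul_comm]; congr 2 <;> abel

theorem sum_sub_mul_add :
    ∑ k, f (k - i) * g (j + k) = ∑ k, g (i + k) * f (k - j) := by
  refine Fintype.sum_equiv (Equiv.addRight (j - i)) _ _ fun k => ?_
  simp only [Equiv.coe_addRight]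
  rw [mul_comm]; congr 2 <;> abel

theorem periodicAutocorr_neg : periodicAutocorr f (-i) = periodicAutocorr f i := by
  refine Fintype.sum_equiv (Equiv.subRight i) _ _ fun k => ?_
  simp only [Equiv.subRight_apply]
  rw [mul_comm, sub_add_cancel, sub_eq_add_neg]

theorem periodicAutocorr_zero (hf : ∀ k, f k = 1 ∨ f k = -1) :
    periodicAutocorr f 0 = Fintype.card G := by
  have h : ∀ k, f k * f k = 1 := fun k => by rcases hf k with h | h <;> simp [h]
  simp [periodicAutocorr, h]

theorem periodicAutocorr_map (e : G ≃+ G) (he : ∀ k, f (e k) = f k) :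
    periodicAutocorr f (e i) = periodicAutocorr f i := by
  refine (Fintype.sum_equiv e.toEquiv _ _ fun k => ?_).symm
  simp [← map_add, he]

end

theorem isHadamardMatrix_goethalsSeidel {G : Type*} [AddCommGroup G] [Fintype G] [DecidableEq G]
    {a b c d : G → ℤ}
    (ha : ∀ k, a k = 1 ∨ a k = -1) (hb : ∀ k, b k = 1 ∨ b k = -1)
    (hc : ∀ k, c k = 1 ∨ c k = -1) (hd : ∀ k, d k = 1 ∨ d k = -1)
    (h : ∀ s, s ≠ 0 → periodicAutocorr a s + periodicAutocorr b s + periodicAutocorr c s +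
      periodicAutocorr d s = 0) :
    IsHadamardMatrix (goethalsSeidel a b c d) := by
  have hneg : ∀ x : ℤ, x = 1 ∨ x = -1 → -x = 1 ∨ -x = -1 := by omega
  refine ⟨?_, ?_⟩
  · rintro ⟨p, i⟩ ⟨q, j⟩
    fin_cases p <;> fin_cases q <;>
      first
      | exact ha _
      | exact hb _
      | exact hc _
      | exact hd _
      | exact hneg _ (hb _)
      | exact hneg _ (hc _)
      | exact hneg _ (hd _)
  · have hdiag : ∀ i j : G, periodicAutocorr a (i - j) + periodicAutocorr b (i - j) +
        periodicAutocorr c (i - j) + periodicAutocorr d (i - j) =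
          if i = j then 4 * (Fintype.card G : ℤ) else 0 := by
      intro i j
      split_ifs with hij
      · subst hij
        rw [sub_self, periodicAutocorr_zero a ha, periodicAutocorr_zero b hb,
          periodicAutocorr_zero c hc, periodicAutocorr_zero d hd]
        ring
      · exact h _ (sub_ne_zero.2 hij)
    ext ⟨p, i⟩ ⟨q, j⟩
    have hij := hdiag i j
    rw [Matrix.mul_apply, Fintype.sum_prod_type, Fin.sum_univ_four, Matrix.smul_apply,
      Matrix.one_apply]
    fin_cases p <;> fin_cases q <;>
      simp [goethalsSeidel, sum_sub_mul_neg_sub, sum_sub_mul_add, sum_neg_sub_mul_neg_sub,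
        sum_sub_mul_sub, sum_add_mul_add] <;>
      linarith [sum_neg_sub_mul_add c d i j, sum_neg_sub_mul_add b d i j,
        sum_neg_sub_mul_add b c i j, sum_add_mul_neg_sub c d i j, sum_add_mul_neg_sub b d i j,
        sum_add_mul_neg_sub b c i j]

theorem IsHadamardMatrix.submatrix {m n : Type*} [Fintype m] [DecidableEq m] [Fintype n]
    [DecidableEq n] {H : Matrix n n ℤ} (hH : IsHadamardMatrix H) (e : m ≃ n) :
    IsHadamardMatrix (H.submatrix e e) := by
  refine ⟨fun i j => hH.1 _ _, ?_⟩
  rw [Matrix.transpose_submatrix, Matrix.submatrix_mul_equiv, hH.2, Matrix.submatrix_smul,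
    Pi.smul_apply, Pi.smul_apply, Matrix.submatrix_one_equiv, Fintype.card_congr e]

/-- The `±1` function on `ℤ/191` which is `-1` on the set with bitmask `m`. -/
def bitSign (m : ℕ) (x : ZMod 191) : ℤ := if m / 2 ^ x.val % 2 = 1 then -1 else 1

theorem bitSign_eq (m : ℕ) (x : ZMod 191) : bitSign m x = 1 ∨ bitSign m x = -1 := by
  unfold bitSign
  split_ifs <;> simp

/-- Multiplication by `39`, an element of order `5` in the unit group of `ℤ/191`. -/
def mulThirtyNine : ZMod 191 ≃+ ZMod 191 where
  toFun x := 39 * x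
  invFun x := 49 * x
  left_inv := by decide +kernel
  right_inv := by decide +kernel
  map_add' := mul_add 39

theorem periodicAutocorr_bitSign_eq_zero :
    ∀ s : ZMod 191, s ≠ 0 →
      periodicAutocorr (bitSign 1934883986007304142905726537739298881778540605276332500352) s +
      periodicAutocorr (bitSign 1934482248948221419364434730566356987500644679921148234376) s +
      periodicAutocorr (bitSign 1546014905719405838931240864540941269304597297800338001994) s +
      periodicAutocorr (bitSign 2762029252406420067839741807215773002048554397085025528008) s =
        0 := by
  have hreps : ∀ s ∈ ([1, 2, 3, 4, 6, 8, 9, 11, 12, 13, 16, 17, 18, 19, 22, 32, 36, 38, 41] :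
      List (ZMod 191)),
      periodicAutocorr (bitSign 1934883986007304142905726537739298881778540605276332500352) s +
      periodicAutocorr (bitSign 1934482248948221419364434730566356987500644679921148234376) s +
      periodicAutocorr (bitSign 1546014905719405838931240864540941269304597297800338001994) s +
      periodicAutocorr (bitSign 2762029252406420067839741807215773002048554397085025528008) s =
        0 := by
    decide +kernel
  have hcover : ∀ s : ZMod 191, s ≠ 0 →
      ∃ r ∈ ([1, 2, 3, 4, 6, 8, 9, 11, 12, 13, 16, 17, 18, 19, 22, 32, 36, 38, 41] :
        List (ZMod 191)), ∃ n : Fin 5,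
        s = mulThirtyNine^[n] r ∨ s = -mulThirtyNine^[n] r := by
    decide +kernel
  have hiter : ∀ m, (∀ k, bitSign m (mulThirtyNine k) = bitSign m k) → ∀ n r,
      periodicAutocorr (bitSign m) (mulThirtyNine^[n] r) = periodicAutocorr (bitSign m) r := by
    intro m hm n r
    induction n with
    | zero => rfl
    | succ n ih => rw [Function.iterate_succ_apply', periodicAutocorr_map _ _ _ hm, ih]
  intro s hs
  obtain ⟨r, hr, n, hn⟩ := hcover s hs
  have hinv : ∀ m, (∀ k, bitSign m (mulThirtyNine k) = bitSign m k) →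
      periodicAutocorr (bitSign m) s = periodicAutocorr (bitSign m) r := by
    intro m hm
    rcases hn with rfl | rfl
    · exact hiter m hm n r
    · rw [periodicAutocorr_neg, hiter m hm n r]
  rw [hinv _ (by decide +kernel), hinv _ (by decide +kernel), hinv _ (by decide +kernel),
    hinv _ (by decide +kernel)]
  exact hreps r hr

/-- There exists a Hadamard matrix of order `764 = 4 · 191`. -/
theorem hadamard_764 :
    ∃ H : Matrix (Fin (4 * 191)) (Fin (4 * 191)) ℤ, IsHadamardMatrix H := by
  exact ⟨_, (isHadamardMatrix_goethalsSeidel (bitSign_eq _) (bitSign_eq _) (bitSign_eq _)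
    (bitSign_eq _) periodicAutocorr_bitSign_eq_zero).submatrix
    (finProdFinEquiv.symm.trans (Equiv.prodCongr (Equiv.refl _) (ZMod.finEquiv 191).toEquiv))⟩
end

section
/- There exists a Hadamard matrix of order 23068 = 4·5767. -/
open Finset Matrix Kronecker

namespace Matrix

variable {n G K : Type*}

section GoethalsSeidel

variable [AddCommGroup n]

/-- The back-circulant permutation matrix of a finite abelian group. -/
def reversal (n : Type*) [AddCommGroup n] [DecidableEq n] : Matrix n n ℤ :=
  of fun i j => if i + j = 0 then 1 else 0

section

variable [DecidableEq n]

theorem reversal_transpose : (reversal n)ᵀ = reversal n := by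
  ext i j
  simp [reversal, add_comm]

variable [Fintype n]

theorem mul_reversal_apply (M : Matrix n n ℤ) (i j : n) :
    (M * reversal n) i j = M i (-j) := by
  simp [reversal, mul_apply, add_eq_zero_iff_eq_neg]

theorem reversal_mul_apply (M : Matrix n n ℤ) (i j : n) :
    (reversal n * M) i j = M (-i) j := by
  simp [reversal, mul_apply, add_eq_zero_iff_neg_eq]

theorem reversal_mul_reversal : reversal n * reversal n = 1 := by
  ext i j
  rw [mul_reversal_apply]
  simp [reversal, one_apply, ← sub_eq_add_neg, sub_eq_zero]

theorem reversal_mul_circulant (v : n → ℤ) :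
    reversal n * circulant v = circulant (fun i => v (-i)) * reversal n := by
  ext i j
  rw [mul_reversal_apply, reversal_mul_apply]
  simp only [circulant_apply]
  congr 1
  abel

theorem reversal_mul_circulant_mul (v : n → ℤ) (M : Matrix n n ℤ) :
    reversal n * (circulant v * M) = circulant (fun i => v (-i)) * (reversal n * M) := by
  rw [← Matrix.mul_assoc, reversal_mul_circulant, Matrix.mul_assoc]

end

theorem circulant_mul_left_comm [Fintype n] (v w : n → ℤ) (M : Matrix n n ℤ) :
    circulant v * (circulant w * M) = circulant w * (circulant v * M) := by
  rw [← Matrix.mul_assoc, circulant_mul_comm, Matrix.mul_assoc]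

variable [DecidableEq n] [Fintype n]

/-- The Goethals–Seidel array built from four group-developed matrices. -/
def goethalsSeidel (a b c d : n → ℤ) :
    Matrix ((n ⊕ n) ⊕ (n ⊕ n)) ((n ⊕ n) ⊕ (n ⊕ n)) ℤ :=
  let A := circulant a
  let B := circulant b
  let C := circulant c
  let D := circulant d
  let R := reversal n
  fromBlocks
    (fromBlocks A (B * R) (-(B * R)) A)
    (fromBlocks (C * R) (D * R) (Dᵀ * R) (-(Cᵀ * R)))
    (fromBlocks (-(C * R)) (-(Dᵀ * R)) (-(D * R)) (Cᵀ * R))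
    (fromBlocks A (Bᵀ * R) (-(Bᵀ * R)) A)

theorem goethalsSeidel_mul_transpose {a b c d : n → ℤ} {m : ℤ}
    (h : circulant a * (circulant a)ᵀ + circulant b * (circulant b)ᵀ +
      circulant c * (circulant c)ᵀ + circulant d * (circulant d)ᵀ = m • 1) :
    goethalsSeidel a b c d * (goethalsSeidel a b c d)ᵀ = m • 1 := by
  have hone : (m • 1 : Matrix ((n ⊕ n) ⊕ (n ⊕ n)) ((n ⊕ n) ⊕ (n ⊕ n)) ℤ) =
      fromBlocks (fromBlocks (m • 1) 0 0 (m • 1)) 0 0 (fromBlocks (m • 1) 0 0 (m • 1)) := by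
    rw [← fromBlocks_one, ← fromBlocks_one]
    simp only [fromBlocks_smul, smul_zero]
  have hzero : (0 : Matrix (n ⊕ n) (n ⊕ n) ℤ) = fromBlocks 0 0 0 0 := fromBlocks_zero.symm
  rw [hone, ← h, hzero]
  simp only [goethalsSeidel, fromBlocks_transpose, fromBlocks_multiply, fromBlocks_add,
    transpose_mul, transpose_neg, reversal_transpose, transpose_circulant, neg_neg,
    Matrix.mul_assoc, Matrix.mul_neg, Matrix.neg_mul,
    reversal_mul_circulant, reversal_mul_circulant_mul, reversal_mul_reversal, Matrix.mul_one,
    circulant_mul_left_comm, circulant_mul_comm]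
  congr 2 <;> abel

theorem goethalsSeidel_apply_eq_one_or {a b c d : n → ℤ}
    (ha : ∀ x, a x = 1 ∨ a x = -1) (hb : ∀ x, b x = 1 ∨ b x = -1)
    (hc : ∀ x, c x = 1 ∨ c x = -1) (hd : ∀ x, d x = 1 ∨ d x = -1)
    (i j : (n ⊕ n) ⊕ (n ⊕ n)) :
    goethalsSeidel a b c d i j = 1 ∨ goethalsSeidel a b c d i j = -1 := by
  rcases i with (i | i) | (i | i) <;> rcases j with (j | j) | (j | j) <;>
    simp only [goethalsSeidel, fromBlocks_apply₁₁, fromBlocks_apply₁₂, fromBlocks_apply₂₁,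
      fromBlocks_apply₂₂, neg_apply, mul_reversal_apply, transpose_apply, circulant_apply,
      neg_inj, neg_eq_iff_eq_neg (b := (1 : ℤ)), or_comm (a := _ = (-1 : ℤ))] <;>
    first | apply ha | apply hb | apply hc | apply hd

end GoethalsSeidel

/-- Periodic autocorrelation as the generator of a Gram matrix of circulants. -/
theorem circulant_mul_transpose_self [AddCommGroup G] [Fintype G] (v : G → ℤ) :
    circulant v * (circulant v)ᵀ = circulant fun s => ∑ k, v (s + k) * v k := by
  ext i j
  simp only [mul_apply, transpose_apply, circulant_apply]
  refine Fintype.sum_equiv (Equiv.subLeft j) _ _ fun k => ?_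
  simp only [Equiv.subLeft_apply]
  congr 2
  abel

theorem sum_circulant_mul_transpose_eq_smul_one [AddCommGroup G] [Fintype G] [DecidableEq G]
    {v : Fin 4 → G → ℤ} {m : ℤ}
    (h : ∀ s, ∑ i, ∑ k, v i (s + k) * v i k = if s = 0 then m else 0) :
    ∑ i, circulant (v i) * (circulant (v i))ᵀ = m • 1 := by
  ext i j
  simp only [circulant_mul_transpose_self, sum_apply, circulant_apply, h, smul_apply, one_apply,
    sub_eq_zero]
  split_ifs <;> simp

/-- The signs of the Williamson array, whose `(r, i)` entry is `± w (r ^^^ i)`. -/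
def williamsonSign : Fin 4 → Fin 4 → ℤ :=
  ![![1, 1, 1, 1], ![-1, 1, 1, -1], ![-1, -1, 1, 1], ![-1, 1, -1, 1]]

theorem williamsonSign_eq_one_or : ∀ r i, williamsonSign r i = 1 ∨ williamsonSign r i = -1 := by
  decide

theorem williamsonSign_mul_xor : ∀ r i j, i ≠ j →
    williamsonSign (r ^^^ i ^^^ j) i * williamsonSign (r ^^^ i ^^^ j) j =
      -(williamsonSign r i * williamsonSign r j) := by
  decide

/-- The columns of the Williamson array of commuting symmetric matrices are orthogonal. -/
theorem sum_williamson_mul_transpose [Fintype K] [DecidableEq K] {W : Fin 4 → Matrix K K ℤ}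
    (hsymm : ∀ i, (W i)ᵀ = W i) (hcomm : ∀ i j, W i * W j = W j * W i) (i j : Fin 4) :
    ∑ r, (williamsonSign r i • W (r ^^^ i)) * (williamsonSign r j • W (r ^^^ j))ᵀ =
      if i = j then ∑ k, W k * (W k)ᵀ else 0 := by
  simp only [transpose_smul, Matrix.smul_mul, Matrix.mul_smul, smul_smul, hsymm]
  split_ifs with hij
  · subst hij
    have hsq : ∀ r, williamsonSign r i * williamsonSign r i = 1 := fun r => by
      rcases williamsonSign_eq_one_or r i with h | h <;> simp [h]
    have hxor : ∀ i r : Fin 4, r ^^^ i ^^^ i = r := by decide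
    have hinv : Function.Involutive fun r : Fin 4 => r ^^^ i := hxor i
    simp only [hsq, one_smul]
    exact hinv.bijective.sum_comp fun k => W k * W k
  · have hxor : ∀ r i j : Fin 4, r ^^^ i ^^^ j ^^^ i = r ^^^ j ∧ r ^^^ i ^^^ j ^^^ j = r ^^^ i ∧
        r ^^^ i ^^^ j ^^^ i ^^^ j = r ∧ (i ≠ j → r ^^^ i ^^^ j ≠ r) := by
      decide
    refine Finset.sum_involution (fun r _ => r ^^^ i ^^^ j) (fun r _ => ?_)
      (fun r _ _ => (hxor r i j).2.2.2 hij) (fun _ _ => mem_univ _) (fun r _ => (hxor r i j).2.2.1)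
    obtain ⟨hi, hj, -⟩ := hxor r i j
    rw [hi, hj, hcomm (r ^^^ j), mul_comm (williamsonSign _ j), mul_comm (williamsonSign _ j),
      williamsonSign_mul_xor r i j hij, neg_smul, add_neg_cancel]

/-- If circulant T-matrices and symmetric circulant Williamson matrices are substituted in the
Williamson array, the Gram matrices add up to a scalar matrix. -/
theorem sum_kronecker_williamson_mul_transpose [Fintype G] [DecidableEq G]
    [Fintype K] [DecidableEq K] {T : Fin 4 → Matrix G G ℤ} {W : Fin 4 → Matrix K K ℤ} {p q : ℤ}
    (hT : ∑ i, T i * (T i)ᵀ = p • 1) (hsymm : ∀ i, (W i)ᵀ = W i)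
    (hcomm : ∀ i j, W i * W j = W j * W i) (hW : ∑ i, W i * (W i)ᵀ = q • 1) :
    ∑ r, (∑ i, T i ⊗ₖ (williamsonSign r i • W (r ^^^ i))) *
      (∑ i, T i ⊗ₖ (williamsonSign r i • W (r ^^^ i)))ᵀ = (p * q) • 1 := by
  calc
    _ = ∑ i, ∑ j, (T i * (T j)ᵀ) ⊗ₖ
        (∑ r, (williamsonSign r i • W (r ^^^ i)) * (williamsonSign r j • W (r ^^^ j))ᵀ) := by
      simp only [transpose_sum, Finset.sum_mul_sum, ← kroneckerMap_transpose, ← mul_kronecker_mul]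
      rw [Finset.sum_comm]
      refine Finset.sum_congr rfl fun i _ => ?_
      rw [Finset.sum_comm]
      refine Finset.sum_congr rfl fun j _ => ?_
      ext x y
      simp only [kroneckerMap_apply, sum_apply, Finset.mul_sum]
    _ = (∑ i, T i * (T i)ᵀ) ⊗ₖ (q • (1 : Matrix K K ℤ)) := by
      simp only [sum_williamson_mul_transpose hsymm hcomm, hW]
      ext x y
      simp [kroneckerMap_apply, sum_apply, Finset.sum_mul, apply_ite]
    _ = _ := by
      rw [hT, smul_kronecker, kronecker_smul, one_kronecker_one, smul_smul]

/-- Turyn's substitution of Williamson matrices in T-matrices, followed by the Goethals–Seidel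
array, for group-developed matrices. -/
theorem exists_isHadamardMatrix_of_tMatrices
    [AddCommGroup G] [Fintype G] [DecidableEq G] [AddCommGroup K] [Fintype K] [DecidableEq K]
    {t : Fin 4 → G → ℤ} {w : Fin 4 → K → ℤ}
    (ht : ∀ x, ∃ i, (t i x = 1 ∨ t i x = -1) ∧ ∀ j, j ≠ i → t j x = 0)
    (htsum : ∀ s, ∑ i, ∑ k, t i (s + k) * t i k = if s = 0 then (Fintype.card G : ℤ) else 0)
    (hw : ∀ i y, w i y = 1 ∨ w i y = -1) (hsymm : ∀ i y, w i (-y) = w i y)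
    (hwsum : ∀ s, ∑ i, ∑ k, w i (s + k) * w i k =
      if s = 0 then 4 * (Fintype.card K : ℤ) else 0)
    {m : ℕ} (hm : m = 4 * (Fintype.card G * Fintype.card K)) :
    ∃ H : Matrix (Fin m) (Fin m) ℤ, IsHadamardMatrix H := by
  let f : Fin 4 → G × K → ℤ := fun r x => ∑ i, t i x.1 * (williamsonSign r i * w (r ^^^ i) x.2)
  have hf : ∀ r x, f r x = 1 ∨ f r x = -1 := by
    intro r x
    obtain ⟨i, hi, hj⟩ := ht x.1
    have hfi : f r x = t i x.1 * (williamsonSign r i * w (r ^^^ i) x.2) :=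
      Finset.sum_eq_single i (fun j _ hne => by rw [hj j hne, zero_mul]) (by simp)
    rw [hfi]
    rcases hi with h₁ | h₁ <;> rcases williamsonSign_eq_one_or r i with h₂ | h₂ <;>
      rcases hw (r ^^^ i) x.2 with h₃ | h₃ <;> simp [h₁, h₂, h₃]
  have hfc : ∀ r, circulant (f r) =
      ∑ i, circulant (t i) ⊗ₖ (williamsonSign r i • circulant (w (r ^^^ i))) := by
    intro r
    ext x y
    simp only [circulant_apply, f, sum_apply, kroneckerMap_apply, smul_apply, smul_eq_mul,
      Prod.fst_sub, Prod.snd_sub]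
  have hsum := sum_kronecker_williamson_mul_transpose
    (W := fun i => circulant (w i))
    (sum_circulant_mul_transpose_eq_smul_one htsum)
    (fun i => by simp only [transpose_circulant, hsymm])
    (fun i j => circulant_mul_comm _ _)
    (sum_circulant_mul_transpose_eq_smul_one hwsum)
  simp only [← hfc, Fin.sum_univ_four] at hsum
  have hcard : Fintype.card ((G × K ⊕ G × K) ⊕ (G × K ⊕ G × K)) = m := by
    simp only [Fintype.card_sum, Fintype.card_prod, hm]
    ring
  let e := (Fintype.equivFinOfCardEq hcard).symm
  refine ⟨(goethalsSeidel (f 0) (f 1) (f 2) (f 3)).submatrix e e, fun i j =>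
    goethalsSeidel_apply_eq_one_or (hf 0) (hf 1) (hf 2) (hf 3) _ _, ?_⟩
  rw [transpose_submatrix, submatrix_mul_equiv, goethalsSeidel_mul_transpose hsum]
  ext i j
  simp only [submatrix_apply, smul_apply, one_apply, e.injective.eq_iff, Fintype.card_fin, hm]
  push_cast
  ring_nf

end Matrix

/-- T-matrices of order 73 in compressed form: the value `±(k + 1)` at `x` means that the
`k`-th sequence is `±1` at `x` and the other three vanish there. -/
def tCode73 : List ℤ :=
  [1, -1, -4, -3, -3, -2, 4, -3, -1, -1, -3, -4, 3, 2, -2, -4, -4, -2, -1, 4, -2, 4, 4, 3,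
   -3, -2, 3, 3, -2, 2, 4, 2, -3, 3, -1, 2, -3, -3, 3, -2, -2, -3, 1, 2, 1, 3, -3, -4, 4, 3,
   2, 2, 2, -1, -2, -4, -3, -1, 3, -1, 1, 2, 3, -2, -1, -1, -2, -2, 3, -3, 3, -1, -1]

/-- The four circulant T-matrices of order 73, invariant under multiplication by 8. -/
def tSeq73 (k : Fin 4) (x : ZMod 73) : ℤ :=
  let c := tCode73.getD x.val 0
  if c = (k.val : ℤ) + 1 then 1 else if c = -((k.val : ℤ) + 1) then -1 else 0

/-- First row of the diagonal block of a two-circulant symmetric conference matrix of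
order 158. -/
def conferenceDiag79 : List ℤ :=
  [0, -1, -1, 1, 1, 1, -1, -1, 1, 1, 1, 1, 1, 1, 1, -1, 1, -1, 1, -1, 1, -1, 1, 1, 1, -1,
   -1, 1, -1, -1, 1, -1, -1, -1, 1, -1, -1, 1, -1, 1, 1, -1, 1, -1, -1, 1, -1, -1, -1, 1,
   -1, -1, 1, -1, -1, 1, 1, 1, -1, 1, -1, 1, -1, 1, -1, 1, 1, 1, 1, 1, 1, 1, -1, -1, 1, 1,
   1, -1, -1]

/-- First row of the off-diagonal block of a two-circulant symmetric conference matrix of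
order 158. -/
def conferenceOff79 : List ℤ :=
  [-1, 1, -1, -1, 1, 1, -1, -1, 1, 1, 1, 1, 1, -1, -1, -1, -1, -1, -1, 1, 1, -1, -1, -1, -1,
   1, -1, -1, -1, 1, -1, 1, 1, -1, 1, -1, 1, 1, -1, -1, -1, -1, 1, 1, -1, 1, -1, 1, 1, -1,
   1, -1, -1, -1, 1, -1, -1, -1, -1, 1, 1, -1, -1, -1, -1, -1, -1, 1, 1, 1, 1, 1, -1, -1, 1,
   1, -1, -1, 1]

/-- Turyn's circulant Williamson matrices of order 79. -/
def williamsonSeq79 (k : Fin 4) (y : ZMod 79) : ℤ :=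
  match k with
  | 0 => conferenceDiag79.getD y.val 0 + if y.val = 0 then 1 else 0
  | 1 => conferenceDiag79.getD y.val 0 - if y.val = 0 then 1 else 0
  | _ => conferenceOff79.getD y.val 0

theorem tSeq73_disjoint : ∀ x, ∃ i, (tSeq73 i x = 1 ∨ tSeq73 i x = -1) ∧
    ∀ j, j ≠ i → tSeq73 j x = 0 := by
  decide +kernel

theorem sum_autocorrelation_tSeq73 :
    ∀ s, ∑ i, ∑ k, tSeq73 i (s + k) * tSeq73 i k = if s = 0 then 73 else 0 := by
  decide +kernel

theorem williamsonSeq79_eq_one_or : ∀ i y, williamsonSeq79 i y = 1 ∨ williamsonSeq79 i y = -1 := by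
  decide +kernel

theorem williamsonSeq79_neg : ∀ i y, williamsonSeq79 i (-y) = williamsonSeq79 i y := by
  decide +kernel

theorem sum_autocorrelation_williamsonSeq79 :
    ∀ s, ∑ i, ∑ k, williamsonSeq79 i (s + k) * williamsonSeq79 i k =
      if s = 0 then 4 * 79 else 0 := by
  decide +kernel

/-- There exists a Hadamard matrix of order `23068 = 4 · 5767`. -/
theorem hadamard_23068 :
    ∃ H : Matrix (Fin (4 * 5767)) (Fin (4 * 5767)) ℤ, IsHadamardMatrix H :=
  Matrix.exists_isHadamardMatrix_of_tMatrices tSeq73_disjoint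
    (by simpa only [ZMod.card, Nat.cast_ofNat] using sum_autocorrelation_tSeq73)
    williamsonSeq79_eq_one_or williamsonSeq79_neg
    (by simpa only [ZMod.card, Nat.cast_ofNat] using sum_autocorrelation_williamsonSeq79)
    (by simp only [ZMod.card])
end

section
/- Near-normal sequences NN(36) exist; in particular, base sequences BS(37,36) exist. -/
open Finset Matrix Kronecker

/-- The `±1` sequence whose `i`-th entry is `-1` exactly when bit `i` of `w` is set. -/
def signSeq (w : ℕ) (i : ℕ) : ℤ := if w.testBit i then -1 else 1

theorem isBinarySeq_signSeq (m w : ℕ) : IsBinarySeq m (signSeq w) := by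
  intro i _
  unfold signSeq
  split <;> simp

theorem autocorr_eq_zero_of_le {m j : ℕ} (X : ℕ → ℤ) (h : m ≤ j) : autocorr m X j = 0 := by
  simp [autocorr, Nat.sub_eq_zero_of_le h]

/-- Only finitely many shifts need to be checked for sign sequences to be base sequences. -/
theorem isBaseSeq_signSeq {r s : ℕ} (a b c d : ℕ) (hsr : s ≤ r)
    (h : ∀ j < r, 1 ≤ j → autocorr r (signSeq a) j + autocorr r (signSeq b) j +
      autocorr s (signSeq c) j + autocorr s (signSeq d) j = 0) :
    IsBaseSeq r s (signSeq a) (signSeq b) (signSeq c) (signSeq d) := by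
  refine ⟨isBinarySeq_signSeq _ _, isBinarySeq_signSeq _ _, isBinarySeq_signSeq _ _,
    isBinarySeq_signSeq _ _, fun j hj => ?_⟩
  rcases lt_or_ge j r with hjr | hrj
  · exact h j hjr hj
  · simp [autocorr_eq_zero_of_le _ hrj, autocorr_eq_zero_of_le _ (hsr.trans hrj)]

theorem isNearNormalSeq_36 :
    IsNearNormalSeq 36 (signSeq 46423811335) (signSeq 70426136493)
      (signSeq 28075443744) (signSeq 19063377876) := by
  refine ⟨isBaseSeq_signSeq _ _ _ _ (by norm_num) ?_, ?_⟩
  · unfold autocorr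
    decide +kernel
  · decide +kernel

/-- Near-normal sequences `NN(36)` exist; in particular, base
sequences `BS(37, 36)` exist. -/
theorem near_normal_36_exists :
    (∃ A B C D : ℕ → ℤ, IsNearNormalSeq 36 A B C D) ∧
    (∃ A B C D : ℕ → ℤ, IsBaseSeq 37 36 A B C D) := by
  exact ⟨⟨_, _, _, _, isNearNormalSeq_36⟩, ⟨_, _, _, _, isNearNormalSeq_36.1⟩⟩
end

section
/- Near-normal sequences NN(38) exist; in particular, base sequences BS(39,38) exist. -/
open Finset Matrix Kronecker

/-- The first sequence of an explicit quadruple in `NN(38)`. -/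
def nearNormal38A (i : ℕ) : ℤ :=
  [
    1, -1, 1, 1, 1, 1, -1, -1, -1, 1, -1, -1, 1, -1, -1, -1, 1, 1, -1,
    1, -1, 1, -1, 1, -1, 1, 1, 1, -1, 1, -1, -1, 1, 1, 1, -1, -1, -1,
    1].getD i 0

/-- The second sequence of an explicit quadruple in `NN(38)`. -/
def nearNormal38B (i : ℕ) : ℤ :=
  [
    1, 1, 1, -1, 1, -1, -1, 1, -1, -1, -1, 1, 1, 1, -1, 1, 1, -1, -1,
    -1, -1, -1, -1, -1, -1, -1, 1, -1, -1, -1, -1, 1, 1, -1, 1, 1, -1, 1,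
    -1].getD i 0

/-- The third sequence of an explicit quadruple in `NN(38)`. -/
def nearNormal38C (i : ℕ) : ℤ :=
  [
    1, 1, -1, -1, 1, 1, -1, -1, -1, -1, 1, 1, 1, -1, 1, 1, 1, 1, -1,
    1, 1, -1, 1, 1, 1, -1, 1, 1, 1, 1, 1, -1, 1, -1, -1, -1, 1, 1].getD i 0

/-- The fourth sequence of an explicit quadruple in `NN(38)`. -/
def nearNormal38D (i : ℕ) : ℤ :=
  [
    1, -1, -1, 1, -1, 1, 1, -1, -1, 1, -1, 1, 1, 1, 1, -1, -1, -1, -1,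
    1, -1, 1, -1, 1, -1, -1, 1, -1, -1, 1, 1, 1, 1, 1, 1, -1, -1, 1].getD i 0

theorem isBaseSeq_nearNormal38 :
    IsBaseSeq 39 38 nearNormal38A nearNormal38B nearNormal38C nearNormal38D := by
  refine ⟨?_, ?_, ?_, ?_, fun j hj => ?_⟩
  · unfold IsBinarySeq; decide +kernel
  · unfold IsBinarySeq; decide +kernel
  · unfold IsBinarySeq; decide +kernel
  · unfold IsBinarySeq; decide +kernel
  · rcases Nat.lt_or_ge j 39 with h | h
    · have key : ∀ j < 39, 1 ≤ j →
          autocorr 39 nearNormal38A j + autocorr 39 nearNormal38B j +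
            autocorr 38 nearNormal38C j + autocorr 38 nearNormal38D j = 0 := by
        unfold autocorr
        decide +kernel
      exact key j h hj
    · have h' : 38 ≤ j := by omega
      simp [autocorr_eq_zero_of_le, h, h']

theorem isNearNormalSeq_nearNormal38 :
    IsNearNormalSeq 38 nearNormal38A nearNormal38B nearNormal38C nearNormal38D :=
  ⟨isBaseSeq_nearNormal38, by decide +kernel⟩

/-- Near-normal sequences `NN(38)` exist; in particular, base
sequences `BS(39, 38)` exist. -/
theorem near_normal_38_exists :
    (∃ A B C D : ℕ → ℤ, IsNearNormalSeq 38 A B C D) ∧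
    (∃ A B C D : ℕ → ℤ, IsBaseSeq 39 38 A B C D) :=
  ⟨⟨_, _, _, _, isNearNormalSeq_nearNormal38⟩, ⟨_, _, _, _, isBaseSeq_nearNormal38⟩⟩
end

section
/- Near-normal sequences NN(40) exist; in particular, base sequences BS(41,40) exist. -/
open Finset Matrix Kronecker

/-- For near-normal sequences it is enough to check the autocorrelations at lags `1, …, n`. -/
theorem isNearNormalSeq_of_checks {n : ℕ} {A B C D : ℕ → ℤ}
    (hA : ∀ i < n + 1, A i = 1 ∨ A i = -1) (hB : ∀ i < n + 1, B i = 1 ∨ B i = -1)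
    (hC : ∀ i < n, C i = 1 ∨ C i = -1) (hD : ∀ i < n, D i = 1 ∨ D i = -1)
    (hsum : ∀ j < n + 1, 1 ≤ j →
      autocorr (n + 1) A j + autocorr (n + 1) B j + autocorr n C j + autocorr n D j = 0)
    (hAB : ∀ i < n, B i = (-1) ^ i * A i) : IsNearNormalSeq n A B C D := by
  refine ⟨⟨hA, hB, hC, hD, fun j hj => ?_⟩, hAB⟩
  rcases lt_or_ge j (n + 1) with h | h
  · exact hsum j h hj
  · simp [autocorr, Nat.sub_eq_zero_of_le h, Nat.sub_eq_zero_of_le (Nat.le_of_succ_le h)]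

/-- The first of the near-normal sequences `NN(40)`, extended by zero. -/
def seqA (i : ℕ) : ℤ :=
  [-1, -1, 1, 1, 1, 1, 1, -1, 1, -1, 1, -1, -1, 1, -1, 1, 1, 1, 1, -1,
    1, -1, 1, 1, 1, -1, -1, -1, 1, -1, 1, -1, -1, 1, 1, -1, -1, 1, 1, 1,
    1].getD i 0

/-- The second of the near-normal sequences `NN(40)`, extended by zero. -/
def seqB (i : ℕ) : ℤ :=
  [-1, 1, 1, -1, 1, -1, 1, 1, 1, 1, 1, 1, -1, -1, -1, -1, 1, -1, 1, 1,
    1, 1, 1, -1, 1, 1, -1, 1, 1, 1, 1, 1, -1, -1, 1, 1, -1, -1, 1, -1,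
    -1].getD i 0

/-- The third of the near-normal sequences `NN(40)`, extended by zero. -/
def seqC (i : ℕ) : ℤ :=
  [1, 1, -1, -1, -1, -1, 1, 1, 1, -1, -1, -1, 1, 1, -1, 1, -1, 1, -1, 1,
    -1, -1, 1, 1, -1, 1, 1, 1, 1, -1, 1, 1, -1, -1, 1, -1, 1, -1, 1, 1].getD i 0

/-- The fourth of the near-normal sequences `NN(40)`, extended by zero. -/
def seqD (i : ℕ) : ℤ :=
  [1, 1, -1, -1, -1, 1, 1, 1, -1, 1, 1, 1, -1, 1, 1, 1, -1, 1, 1, -1,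
    1, 1, 1, 1, -1, -1, 1, -1, -1, 1, -1, -1, -1, -1, -1, -1, 1, -1, 1, 1].getD i 0

/-- Near-normal sequences `NN(40)` exist; in particular, base
sequences `BS(41, 40)` exist. -/
theorem near_normal_40_exists :
    (∃ A B C D : ℕ → ℤ, IsNearNormalSeq 40 A B C D) ∧
    (∃ A B C D : ℕ → ℤ, IsBaseSeq 41 40 A B C D) := by
  have h : IsNearNormalSeq 40 seqA seqB seqC seqD :=
    isNearNormalSeq_of_checks (by decide +kernel) (by decide +kernel) (by decide +kernel)
      (by decide +kernel) (by decide +kernel) (by decide +kernel)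
  exact ⟨⟨seqA, seqB, seqC, seqD, h⟩, ⟨seqA, seqB, seqC, seqD, h.1⟩⟩
end
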